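/- arXiv:2111.04622 — 4 statements merged into one kernel-verified Lean document; each statement's English description precedes it below -/
import Mathlib

section
/- Let M be a complex vector space equipped with a rank-r Weyl system t_1,…,t_r, ∂_1,…,∂_r, and let θ := Σ_{i=1}^r t_i∘∂_i. For 0 ≤ ℓ ≤ r set K^ℓ := M ⊗ Λ^ℓ(ℂ^r), define d_ℓ : K^ℓ → K^{ℓ+1} by d_ℓ(m⊗ω) = Σ_{i=1}^r t_i(m)⊗(e_i∧ω) and s_ℓ : K^ℓ → K^{ℓ-1} by s_ℓ(m⊗ω) = Σ_{j=1}^r ∂_j(m)⊗ι_{e_j^*}(ω), where ι_{e_j^*} denotes contraction with the j-th dual basis vector (conventions d_r = 0, s_0 = 0). Then d_{ℓ+1}∘d_ℓ = 0 for all ℓ, and for every 0 ≤ ℓ ≤ r one has the homotopy identity s_{ℓ+1}∘d_ℓ + d_{ℓ-1}∘s_ℓ = θ⊗id_{Λ^ℓ(ℂ^r)} + (r−ℓ)·id on K^ℓ. -/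
open TensorProduct

noncomputable section

/-- Wedging on the left with a fixed vector `v`, as a linear map `⋀^ℓ M → ⋀^(ℓ+1) M`,
`ω ↦ v ∧ ω`. -/
def wedgeMap (R : Type*) [CommRing R] {M : Type*} [AddCommGroup M] [Module R M]
    (v : M) (ℓ : ℕ) : ⋀[R]^ℓ M →ₗ[R] ⋀[R]^(ℓ+1) M :=
  LinearMap.codRestrict _
    ((LinearMap.mulLeft R (ExteriorAlgebra.ι R v)).comp (Submodule.subtype _))
    (fun ω => by
      have h : ExteriorAlgebra.ι R v * (ω : ExteriorAlgebra R M) ∈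
          (LinearMap.range (ExteriorAlgebra.ι R : M →ₗ[R] ExteriorAlgebra R M)) ^ (ℓ + 1) := by
        rw [pow_succ']
        exact Submodule.mul_mem_mul (LinearMap.mem_range_self _ v) ω.2
      simpa using h)

/-- The monomial `v 0 ∧ ⋯ ∧ v (n-1)` as an element of `⋀^n M`. -/
def wedgeMonomial (R : Type*) [CommRing R] {M : Type*} [AddCommGroup M] [Module R M]
    (n : ℕ) (v : Fin n → M) : ⋀[R]^n M :=
  ⟨ExteriorAlgebra.ιMulti R n v, ExteriorAlgebra.ιMulti_range R n (Set.mem_range_self _)⟩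

/-- Wedging a monomial with a vector prepends that vector. -/
theorem wedgeMap_wedgeMonomial {R : Type*} [CommRing R] {M : Type*} [AddCommGroup M] [Module R M]
    (v : M) {n : ℕ} (w : Fin n → M) :
    wedgeMap R v n (wedgeMonomial R n w) = wedgeMonomial R (n + 1) (Matrix.vecCons v w) := by
  apply Subtype.ext
  simp [wedgeMap, wedgeMonomial]

/-- Wedging a monomial with its `k`-th factor removed by that factor restores it up to the sign
`(-1)^k`. -/
theorem wedgeMap_wedgeMonomial_succAbove {R : Type*} [CommRing R] {M : Type*} [AddCommGroup M]
    [Module R M] {n : ℕ} (v : Fin (n + 1) → M) (k : Fin (n + 1)) :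
    wedgeMap R (v k) n (wedgeMonomial R n fun j => v (k.succAbove j)) =
      (-1 : R) ^ (k : ℕ) • wedgeMonomial R (n + 1) v := by
  rw [wedgeMap_wedgeMonomial]
  apply Subtype.ext
  have h := (ExteriorAlgebra.ιMulti R (M := M) (n + 1)).neg_one_pow_smul_map_insertNth k (v k)
    (k.removeNth v)
  rw [Fin.insertNth_self_removeNth] at h
  calc ExteriorAlgebra.ιMulti R (n + 1) (Matrix.vecCons (v k) fun j => v (k.succAbove j))
      = (-1 : ℤ) ^ (k : ℕ) • ExteriorAlgebra.ιMulti R (n + 1) v := h.symm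
    _ = (-1 : R) ^ (k : ℕ) • ExteriorAlgebra.ιMulti R (n + 1) v := by
      rcases Nat.even_or_odd (k : ℕ) with hk | hk <;> simp [hk.neg_one_pow]

/-- Wedging with two vectors is antisymmetric in the two vectors. -/
theorem wedgeMap_wedgeMap_comm {R : Type*} [CommRing R] {M : Type*} [AddCommGroup M] [Module R M]
    (v w : M) {n : ℕ} (ω : ⋀[R]^n M) :
    wedgeMap R v (n + 1) (wedgeMap R w n ω) = -wedgeMap R w (n + 1) (wedgeMap R v n ω) := by
  apply Subtype.ext
  change ExteriorAlgebra.ι R v * (ExteriorAlgebra.ι R w * (ω : ExteriorAlgebra R M)) =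
    -(ExteriorAlgebra.ι R w * (ExteriorAlgebra.ι R v * (ω : ExteriorAlgebra R M)))
  rw [← mul_assoc, ← mul_assoc, ← neg_mul,
    eq_neg_of_add_eq_zero_left (ExteriorAlgebra.ι_add_mul_swap v w)]

/-- Linear maps out of `M ⊗ ⋀^n V` agree if they agree on the tensors of elements of `M` with
monomials in basis vectors. -/
theorem tensor_exteriorPower_ext_basis {R : Type*} [CommRing R] {M V N I : Type*}
    [AddCommGroup M] [Module R M] [AddCommGroup V] [Module R V] [AddCommGroup N] [Module R N]
    (b : Module.Basis I R V) {n : ℕ} {f g : (M ⊗[R] ⋀[R]^n V) →ₗ[R] N}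
    (h : ∀ (m : M) (σ : Fin n → I),
      f (m ⊗ₜ[R] wedgeMonomial R n fun j => b (σ j)) =
        g (m ⊗ₜ[R] wedgeMonomial R n fun j => b (σ j))) : f = g := by
  apply TensorProduct.ext
  ext1 m
  apply exteriorPower.linearMap_ext
  exact b.ext_alternating fun σ _ => h m σ

/-- Let `M` be a complex vector space with a rank-`r` Weyl system
`t_1, …, t_r, ∂_1, …, ∂_r`, and `θ := Σᵢ tᵢ ∘ ∂ᵢ`.  Set `K^ℓ := M ⊗ Λ^ℓ(ℂ^r)`, let
`d_ℓ : K^ℓ → K^{ℓ+1}` be given by `m ⊗ ω ↦ Σᵢ tᵢ(m) ⊗ (eᵢ ∧ ω)` and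
`s_{ℓ+1} : K^{ℓ+1} → K^ℓ` (here `S ℓ = s_{ℓ+1}`, so the convention `s_0 = 0` is
built in) be given by `m ⊗ ω ↦ Σⱼ ∂ⱼ(m) ⊗ ι_{eⱼ*}(ω)`, i.e. on basis monomials
`m ⊗ e_{σ 0} ∧ ⋯ ∧ e_{σ ℓ} ↦ Σₖ (-1)^k ∂_{σ k}(m) ⊗ (e_{σ 0} ∧ ⋯ ∧ ê_{σ k} ∧ ⋯)`.
Then `d_{ℓ+1} ∘ d_ℓ = 0` for all `ℓ` and for every `0 ≤ ℓ ≤ r` one has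
`s_{ℓ+1} ∘ d_ℓ + d_{ℓ-1} ∘ s_ℓ = θ ⊗ id + (r - ℓ) · id` on `K^ℓ`. -/
theorem statement0 (r : ℕ) (hr : 1 ≤ r)
    (M : Type*) [AddCommGroup M] [Module ℂ M]
    (t d : Fin r → Module.End ℂ M)
    (htt : ∀ i j, t i * t j = t j * t i)
    (hdd : ∀ i j, d i * d j = d j * d i)
    (hdt : ∀ i j, d i * t j - t j * d i = if i = j then 1 else 0)
    (θ : Module.End ℂ M) (hθ : θ = ∑ i, t i * d i)
    (D : ∀ ℓ : ℕ, (M ⊗[ℂ] ⋀[ℂ]^ℓ (Fin r → ℂ)) →ₗ[ℂ] (M ⊗[ℂ] ⋀[ℂ]^(ℓ+1) (Fin r → ℂ)))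
    (S : ∀ ℓ : ℕ, (M ⊗[ℂ] ⋀[ℂ]^(ℓ+1) (Fin r → ℂ)) →ₗ[ℂ] (M ⊗[ℂ] ⋀[ℂ]^ℓ (Fin r → ℂ)))
    (hD : ∀ (ℓ : ℕ) (m : M) (ω : ⋀[ℂ]^ℓ (Fin r → ℂ)),
      D ℓ (m ⊗ₜ[ℂ] ω) = ∑ i, (t i m) ⊗ₜ[ℂ] (wedgeMap ℂ (Pi.single i 1) ℓ ω))
    (hS : ∀ (ℓ : ℕ) (σ : Fin (ℓ+1) → Fin r) (m : M),
      S ℓ (m ⊗ₜ[ℂ] wedgeMonomial ℂ (ℓ+1) (fun j => Pi.single (σ j) 1)) =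
        ∑ k : Fin (ℓ+1), ((-1 : ℂ))^(k : ℕ) •
          ((d (σ k) m) ⊗ₜ[ℂ] wedgeMonomial ℂ ℓ (fun j => Pi.single (σ (k.succAbove j)) 1))) :
    (∀ ℓ : ℕ, (D (ℓ+1)).comp (D ℓ) = 0) ∧
    ((S 0).comp (D 0) = LinearMap.rTensor _ θ + (r : ℂ) • LinearMap.id) ∧
    (∀ ℓ : ℕ, ℓ + 1 ≤ r →
      (S (ℓ+1)).comp (D (ℓ+1)) + (D ℓ).comp (S ℓ) =
        LinearMap.rTensor _ θ + ((r : ℂ) - ((ℓ : ℂ) + 1)) • LinearMap.id) := by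
  have hdt' : ∀ i j m, d i (t j m) = t j (d i m) + if i = j then m else 0 := by
    intro i j m
    have h := LinearMap.congr_fun (hdt i j) m
    rw [LinearMap.sub_apply, Module.End.mul_apply, Module.End.mul_apply, sub_eq_iff_eq_add'] at h
    rw [h]
    split_ifs <;> simp
  have hsum : ∀ m, ∑ i, d i (t i m) = θ m + (r : ℂ) • m := by
    intro m
    simp [hdt', hθ, Finset.sum_add_distrib, Nat.cast_smul_eq_nsmul]
  have hcons : ∀ {n : ℕ} (i : Fin r) (σ : Fin n → Fin r),
      wedgeMap ℂ (Pi.single i 1 : Fin r → ℂ) n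
          (wedgeMonomial ℂ n fun j => (Pi.single (σ j) 1 : Fin r → ℂ)) =
        wedgeMonomial ℂ (n + 1)
          fun j => (Pi.single ((Fin.cons i σ : Fin (n + 1) → Fin r) j) 1 : Fin r → ℂ) := by
    intro n i σ
    rw [wedgeMap_wedgeMonomial]
    congr 1
    funext j
    cases j using Fin.cases <;> simp
  refine ⟨fun ℓ => ?_, ?_, fun ℓ _ => ?_⟩
  · apply TensorProduct.ext'
    intro m ω
    simp only [LinearMap.comp_apply, hD, map_sum, LinearMap.zero_apply]
    have := IsAddTorsionFree.of_isTorsionFree ℂ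
      (M ⊗[ℂ] ⋀[ℂ]^(ℓ + 1 + 1) (Fin r → ℂ))
    rw [← self_eq_neg]
    conv_lhs => rw [Finset.sum_comm]
    simp only [← Finset.sum_neg_distrib]
    refine Finset.sum_congr rfl fun i _ => Finset.sum_congr rfl fun j _ => ?_
    rw [wedgeMap_wedgeMap_comm, TensorProduct.tmul_neg, ← Module.End.mul_apply, htt,
      Module.End.mul_apply]
  · apply tensor_exteriorPower_ext_basis (Pi.basisFun ℂ (Fin r))
    intro m σ
    simp only [Pi.basisFun_apply, LinearMap.comp_apply, hD, map_sum, hcons, hS,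
      LinearMap.add_apply, LinearMap.smul_apply, LinearMap.rTensor_tmul, LinearMap.id_apply,
      Fin.sum_univ_succ, Fin.cons_zero, Fin.zero_succAbove, Fin.cons_succ]
    simp [← TensorProduct.sum_tmul, hsum, TensorProduct.add_tmul, TensorProduct.smul_tmul']
  · apply tensor_exteriorPower_ext_basis (Pi.basisFun ℂ (Fin r))
    intro m σ
    have hremove : ∀ (i : Fin r) (k : Fin (ℓ + 1)),
        (wedgeMonomial ℂ (ℓ + 1) fun j =>
          (Pi.single ((Fin.cons i σ : Fin (ℓ + 2) → Fin r) (k.succ.succAbove j)) 1 : Fin r → ℂ)) =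
        wedgeMap ℂ (Pi.single i 1 : Fin r → ℂ) ℓ
          (wedgeMonomial ℂ ℓ fun j => (Pi.single (σ (k.succAbove j)) 1 : Fin r → ℂ)) := by
      intro i k
      rw [hcons i fun j => σ (k.succAbove j)]
      congr 1
      funext j
      cases j using Fin.cases <;> simp
    simp only [Pi.basisFun_apply, LinearMap.add_apply, LinearMap.comp_apply, LinearMap.smul_apply,
      LinearMap.rTensor_tmul, LinearMap.id_apply, hD, hS, map_sum, map_smul, hcons]
    simp only [Fin.sum_univ_succ (n := ℓ + 1), hremove, Fin.cons_zero, Fin.zero_succAbove,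
      Fin.cons_succ, Fin.val_zero, pow_zero, one_smul, Fin.val_succ, Finset.sum_add_distrib,
      ← TensorProduct.sum_tmul, hsum]
    have hcancel : ∀ k : Fin (ℓ + 1),
        (∑ i, (-1 : ℂ) ^ ((k : ℕ) + 1) • (d (σ k) (t i m) ⊗ₜ[ℂ]
          wedgeMap ℂ (Pi.single i 1 : Fin r → ℂ) ℓ (wedgeMonomial ℂ ℓ
            fun j => (Pi.single (σ (k.succAbove j)) 1 : Fin r → ℂ)))) +
        (-1 : ℂ) ^ (k : ℕ) • (∑ i, t i (d (σ k) m) ⊗ₜ[ℂ] wedgeMap ℂ (Pi.single i 1 : Fin r → ℂ) ℓ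
          (wedgeMonomial ℂ ℓ fun j => (Pi.single (σ (k.succAbove j)) 1 : Fin r → ℂ))) =
        -(m ⊗ₜ[ℂ] wedgeMonomial ℂ (ℓ + 1) fun j => (Pi.single (σ j) 1 : Fin r → ℂ)) := by
      intro k
      have hk := wedgeMap_wedgeMonomial_succAbove (R := ℂ)
        (fun j => (Pi.single (σ j) 1 : Fin r → ℂ)) k
      rw [← Finset.smul_sum, pow_succ, mul_neg_one, neg_smul]
      simp only [hdt', TensorProduct.add_tmul, Finset.sum_add_distrib, smul_add]
      have hδ : ∑ i, (if σ k = i then m else 0) ⊗ₜ[ℂ] wedgeMap ℂ (Pi.single i 1 : Fin r → ℂ) ℓ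
          (wedgeMonomial ℂ ℓ fun j => (Pi.single (σ (k.succAbove j)) 1 : Fin r → ℂ)) =
          (-1 : ℂ) ^ (k : ℕ) •
            (m ⊗ₜ[ℂ] wedgeMonomial ℂ (ℓ + 1) fun j => (Pi.single (σ j) 1 : Fin r → ℂ)) := by
        simp only [TensorProduct.ite_tmul]
        rw [Finset.sum_ite_eq, if_pos (Finset.mem_univ _), hk, TensorProduct.tmul_smul]
      rw [hδ, smul_smul, ← mul_pow]
      simp
    rw [Finset.sum_comm, add_assoc, ← Finset.sum_add_distrib]
    simp only [← hcons, hcancel]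
    simp only [Finset.sum_const, Finset.card_univ, Fintype.card_fin, TensorProduct.add_tmul,
      ← TensorProduct.smul_tmul', ← Nat.cast_smul_eq_nsmul ℂ]
    push_cast
    module
end
end

section
/- Let M be a complex vector space equipped with a rank-r Weyl system t_1,…,t_r, ∂_1,…,∂_r, set θ := Σ_{i=1}^r t_i∘∂_i, and let (V^χ)_{χ∈ℚ} be an abstract V-filtration on M. Then for every rational number α ≠ 0 the Koszul-type complex B^α, whose ℓ-th term (ℓ = 0,…,r) is gr^{α+ℓ}(M) ⊗ Λ^ℓ(ℂ^r) and whose differential is induced by m⊗ω ↦ Σ_{i=1}^r t_i(m)⊗(e_i∧ω), is exact. -/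
open TensorProduct

noncomputable section

/-- `V^{>χ} := ⋃_{β > χ} V^β` (a union of a directed family of subspaces, hence the sup). -/
def Vgt {M : Type*} [AddCommGroup M] [Module ℂ M] (V : ℚ → Submodule ℂ M) (χ : ℚ) :
    Submodule ℂ M :=
  ⨆ β > χ, V β

/-- The graded piece `gr^χ(M) := V^χ / V^{>χ}`. -/
abbrev Gr {M : Type*} [AddCommGroup M] [Module ℂ M] (V : ℚ → Submodule ℂ M) (χ : ℚ) :
    Type _ :=
  (V χ) ⧸ ((Vgt V χ).comap (V χ).subtype)

section Contraction

variable {R : Type*} [CommRing R] {M : Type*} [AddCommGroup M] [Module R M]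

theorem contractLeft_mem_exteriorPower (f : Module.Dual R M) (n : ℕ) :
    ∀ x ∈ ⋀[R]^(n + 1) M,
      CliffordAlgebra.contractLeft (Q := (0 : QuadraticForm R M)) f x ∈ ⋀[R]^n M := by
  induction n with
  | zero =>
    intro x hx
    have hx' : x ∈ (LinearMap.range (ExteriorAlgebra.ι R : M →ₗ[R] ExteriorAlgebra R M)) ^ 1 := hx
    rw [pow_one] at hx'
    obtain ⟨a, rfl⟩ := hx'
    change _ ∈ (LinearMap.range (ExteriorAlgebra.ι R : M →ₗ[R] ExteriorAlgebra R M)) ^ 0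
    rw [pow_zero]
    exact Submodule.mem_one.2 ⟨f a, (CliffordAlgebra.contractLeft_ι _ f a).symm⟩
  | succ n ih =>
    intro x hx
    have hx' : x ∈ (LinearMap.range (ExteriorAlgebra.ι R : M →ₗ[R] ExteriorAlgebra R M)) *
        (LinearMap.range (ExteriorAlgebra.ι R : M →ₗ[R] ExteriorAlgebra R M)) ^ (n + 1) := by
      rw [← pow_succ']; exact hx
    induction hx' using Submodule.mul_induction_on' with
    | mem_mul_mem a ha b hb =>
      obtain ⟨a, rfl⟩ := ha
      have h := CliffordAlgebra.contractLeft_ι_mul (Q := (0 : QuadraticForm R M)) (d := f) a b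
      refine (congrArg (· ∈ ⋀[R]^(n + 1) M) h).mpr (Submodule.sub_mem _ ?_ ?_)
      · exact Submodule.smul_mem _ _ hb
      · change _ ∈ (LinearMap.range (ExteriorAlgebra.ι R : M →ₗ[R] ExteriorAlgebra R M)) ^ (n + 1)
        rw [pow_succ']
        exact Submodule.mul_mem_mul (LinearMap.mem_range_self _ a) (ih b hb)
    | add a ha b hb iha ihb =>
      rw [map_add]
      rw [← pow_succ'] at ha hb
      exact Submodule.add_mem _ (iha ha) (ihb hb)

/-- Left contraction with a linear form `f`, as a linear map `⋀^(n+1) M → ⋀^n M`. -/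
def contractionMap (f : Module.Dual R M) (n : ℕ) : ⋀[R]^(n + 1) M →ₗ[R] ⋀[R]^n M :=
  (CliffordAlgebra.contractLeft (Q := (0 : QuadraticForm R M)) f).restrict
    (contractLeft_mem_exteriorPower f n)

theorem contractionMap_wedgeMap_zero (f : Module.Dual R M) (v : M) (ω : ⋀[R]^0 M) :
    contractionMap f 0 (wedgeMap R v 0 ω) = f v • ω := by
  have hω : (ω : ExteriorAlgebra R M) ∈
      (LinearMap.range (ExteriorAlgebra.ι R : M →ₗ[R] ExteriorAlgebra R M)) ^ 0 := ω.2
  rw [pow_zero] at hω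
  obtain ⟨c, hc⟩ := Submodule.mem_one.1 hω
  apply Subtype.ext
  refine (CliffordAlgebra.contractLeft_ι_mul (Q := (0 : QuadraticForm R M)) (d := f) v
    (ω : ExteriorAlgebra R M)).trans ?_
  have h0 : CliffordAlgebra.contractLeft (Q := (0 : QuadraticForm R M)) f
      (ω : ExteriorAlgebra R M) = 0 := by
    rw [← hc]; exact CliffordAlgebra.contractLeft_algebraMap _ f c
  rw [h0, mul_zero, sub_zero]
  rfl

theorem contractionMap_wedgeMap_succ (f : Module.Dual R M) (v : M) (n : ℕ)
    (ω : ⋀[R]^(n + 1) M) :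
    contractionMap f (n + 1) (wedgeMap R v (n + 1) ω) =
      f v • ω - wedgeMap R v n (contractionMap f n ω) :=
  Subtype.ext (CliffordAlgebra.contractLeft_ι_mul (Q := (0 : QuadraticForm R M)) (d := f) v
    (ω : ExteriorAlgebra R M))

theorem sum_ι_mul_contractLeft {r : ℕ} (n : ℕ) :
    ∀ x ∈ ⋀[R]^n (Fin r → R),
      ∑ i, ExteriorAlgebra.ι R (Pi.single i (1 : R) : Fin r → R) *
        (CliffordAlgebra.contractLeft (Q := (0 : QuadraticForm R (Fin r → R)))
          (LinearMap.proj i) x : ExteriorAlgebra R (Fin r → R)) = (n : R) • x := by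
  induction n with
  | zero =>
    intro x hx
    have hx' : x ∈ (LinearMap.range
      (ExteriorAlgebra.ι R : (Fin r → R) →ₗ[R] ExteriorAlgebra R (Fin r → R))) ^ 0 := hx
    rw [pow_zero] at hx'
    obtain ⟨c, rfl⟩ := Submodule.mem_one.1 hx'
    rw [Nat.cast_zero, zero_smul]
    refine Finset.sum_eq_zero fun i _ => ?_
    refine (congrArg _ (CliffordAlgebra.contractLeft_algebraMap _ _ c)).trans (mul_zero _)
  | succ n ih =>
    intro x hx
    have hx' : x ∈ (LinearMap.range
        (ExteriorAlgebra.ι R : (Fin r → R) →ₗ[R] ExteriorAlgebra R (Fin r → R))) *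
        (LinearMap.range
        (ExteriorAlgebra.ι R : (Fin r → R) →ₗ[R] ExteriorAlgebra R (Fin r → R))) ^ n := by
      rw [← pow_succ']; exact hx
    induction hx' using Submodule.mul_induction_on' with
    | mem_mul_mem a ha b hb =>
      obtain ⟨a, rfl⟩ := ha
      have key : ∀ i : Fin r, ExteriorAlgebra.ι R (Pi.single i (1 : R) : Fin r → R) *
          (CliffordAlgebra.contractLeft (Q := (0 : QuadraticForm R (Fin r → R)))
            (LinearMap.proj i) (ExteriorAlgebra.ι R a * b) : ExteriorAlgebra R (Fin r → R)) =
          ExteriorAlgebra.ι R (a i • (Pi.single i (1 : R) : Fin r → R)) * b +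
          ExteriorAlgebra.ι R a * (ExteriorAlgebra.ι R (Pi.single i (1 : R) : Fin r → R) *
          (CliffordAlgebra.contractLeft (Q := (0 : QuadraticForm R (Fin r → R)))
            (LinearMap.proj i) b : ExteriorAlgebra R (Fin r → R))) := by
        intro i
        have h := CliffordAlgebra.contractLeft_ι_mul (Q := (0 : QuadraticForm R (Fin r → R)))
          (d := LinearMap.proj i) a b
        refine (congrArg (ExteriorAlgebra.ι R (Pi.single i (1 : R) : Fin r → R) * ·) h).trans ?_
        have h2 : ExteriorAlgebra.ι R (Pi.single i (1 : R) : Fin r → R) * ExteriorAlgebra.ι R a =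
            - (ExteriorAlgebra.ι R a * ExteriorAlgebra.ι R (Pi.single i (1 : R))) :=
          eq_neg_of_add_eq_zero_left (ExteriorAlgebra.ι_add_mul_swap _ _)
        refine (mul_sub _ _ _).trans ?_
        rw [sub_eq_add_neg]
        congr 1
        · rw [map_smul, smul_mul_assoc]
          exact mul_smul_comm _ _ _
        · refine (congrArg Neg.neg ((mul_assoc _ _ _).symm.trans (congrArg (· * _) h2))).trans ?_
          refine (congrArg Neg.neg (neg_mul _ _)).trans ?_
          rw [neg_neg, mul_assoc]
      rw [Finset.sum_congr rfl fun i _ => key i, Finset.sum_add_distrib, ← Finset.sum_mul,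
        ← Finset.mul_sum, ih b hb, ← map_sum, ← pi_eq_sum_univ' a, mul_smul_comm,
        Nat.cast_add, Nat.cast_one, add_smul, one_smul, add_comm]
    | add a ha b hb iha ihb =>
      rw [← pow_succ'] at ha hb
      rw [smul_add, ← iha ha, ← ihb hb, ← Finset.sum_add_distrib]
      refine Finset.sum_congr rfl fun i _ => ?_
      rw [map_add]
      exact mul_add _ _ _

theorem sum_wedgeMap_contractionMap {r : ℕ} (n : ℕ) (ω : ⋀[R]^(n + 1) (Fin r → R)) :
    ∑ i, wedgeMap R (Pi.single i 1) n (contractionMap (LinearMap.proj i) n ω) =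
      ((n + 1 : ℕ) : R) • ω := by
  apply Subtype.ext
  rw [AddSubmonoidClass.coe_finsetSum]
  exact sum_ι_mul_contractLeft (n + 1) (ω : ExteriorAlgebra R (Fin r → R)) ω.2

end Contraction

/-- If `L` maps `K` into `S ≤ K` and `L = N + a` with `a ≠ 0`, then every `N`-nilpotent
vector of `K` lies in `S`. -/
theorem mem_of_nilpotent_add_smul {k C : Type*} [Field k] [AddCommGroup C] [Module k C]
    {K S : Submodule k C} (hSK : S ≤ K) {N : Module.End k C} {a : k} (ha : a ≠ 0)
    (hL : ∀ x ∈ K, N x + a • x ∈ S) (m : ℕ) :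
    ∀ x ∈ K, (N ^ m) x = 0 → x ∈ S := by
  induction m with
  | zero => intro x _ h; simp at h; simp [h]
  | succ m ih =>
    intro x hx h
    have hNK : N x ∈ K := by
      simpa using K.sub_mem (hSK (hL x hx)) (K.smul_mem a hx)
    have hN : N x ∈ S := ih _ hNK (by rwa [pow_succ] at h)
    have : a • x ∈ S := by simpa using S.sub_mem (hL x hx) hN
    exact (S.smul_mem_iff ha).1 this

theorem exists_rTensor_pow_eq_zero {k A B : Type*} [Field k] [AddCommGroup A] [Module k A]
    [AddCommGroup B] [Module k B] (N : Module.End k A) (hN : ∀ x, ∃ m : ℕ, (N ^ m) x = 0)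
    (z : A ⊗[k] B) : ∃ m : ℕ, ((N.rTensor B : Module.End k (A ⊗[k] B)) ^ m) z = 0 := by
  induction z with
  | zero => exact ⟨0, by simp⟩
  | tmul x y =>
    obtain ⟨m, hm⟩ := hN x
    exact ⟨m, by rw [LinearMap.rTensor_pow, LinearMap.rTensor_tmul, hm, zero_tmul]⟩
  | add x y hx hy =>
    obtain ⟨m, hm⟩ := hx
    obtain ⟨m', hm'⟩ := hy
    exact ⟨m + m', by rw [map_add, Module.End.pow_map_zero_of_le (Nat.le_add_right m m') hm,
      Module.End.pow_map_zero_of_le (Nat.le_add_left m' m) hm', add_zero]⟩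

section Graded

variable {M : Type*} [AddCommGroup M] [Module ℂ M] (V : ℚ → Submodule ℂ M)

theorem map_mem_Vgt {f : Module.End ℂ M} {c : ℚ} (hf : ∀ χ : ℚ, ∀ m ∈ V χ, f m ∈ V (χ + c))
    (χ : ℚ) : ∀ m ∈ Vgt V χ, f m ∈ Vgt V (χ + c) := by
  change Vgt V χ ≤ (Vgt V (χ + c)).comap f
  refine iSup₂_le fun β hβ m hm => ?_
  exact (le_iSup₂ (f := fun β (_ : β > χ + c) => V β) (β + c)
    (by simpa using hβ)) (hf β m hm)

theorem exists_grMap {f : Module.End ℂ M} {c : ℚ} (hf : ∀ χ : ℚ, ∀ m ∈ V χ, f m ∈ V (χ + c))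
    (χ χ' : ℚ) (h : χ + c = χ') :
    ∃ F : Gr V χ →ₗ[ℂ] Gr V χ', ∀ (m : M) (hm : m ∈ V χ) (hm' : f m ∈ V χ'),
      F (Submodule.Quotient.mk ⟨m, hm⟩) = Submodule.Quotient.mk ⟨f m, hm'⟩ := by
  subst h
  exact ⟨Submodule.mapQ _ _ (f.restrict (hf χ)) fun x hx => map_mem_Vgt V hf χ x hx,
    fun _ _ _ => rfl⟩

end Graded

section Koszul

variable {r : ℕ} {A : ℕ → Type*} [∀ n, AddCommGroup (A n)] [∀ n, Module ℂ (A n)]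
  (T : ∀ n, Fin r → (A n →ₗ[ℂ] A (n + 1))) (D : ∀ n, Fin r → (A (n + 1) →ₗ[ℂ] A n))
  (δ : ∀ n : ℕ, (A n ⊗[ℂ] ⋀[ℂ]^n (Fin r → ℂ)) →ₗ[ℂ]
    (A (n + 1) ⊗[ℂ] ⋀[ℂ]^(n + 1) (Fin r → ℂ)))

/-- The contracting homotopy `Σᵢ Dᵢ ⊗ ι(eᵢ*)` of the Koszul complex. -/
def koszulHomotopy (n : ℕ) : (A (n + 1) ⊗[ℂ] ⋀[ℂ]^(n + 1) (Fin r → ℂ)) →ₗ[ℂ]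
    (A n ⊗[ℂ] ⋀[ℂ]^n (Fin r → ℂ)) :=
  ∑ i, TensorProduct.map (D n i) (contractionMap (LinearMap.proj i) n)

theorem koszulHomotopy_tmul (n : ℕ) (x : A (n + 1)) (ω : ⋀[ℂ]^(n + 1) (Fin r → ℂ)) :
    koszulHomotopy D n (x ⊗ₜ ω) =
      ∑ i, D n i x ⊗ₜ contractionMap (LinearMap.proj i) n ω := by
  simp [koszulHomotopy, LinearMap.sum_apply]

variable {T D δ}

theorem koszulHomotopy_differential_zero
    (hδ : ∀ (n : ℕ) (x : A n) (ω : ⋀[ℂ]^n (Fin r → ℂ)),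
      δ n (x ⊗ₜ[ℂ] ω) = ∑ i, (T n i x) ⊗ₜ[ℂ] (wedgeMap ℂ (Pi.single i 1) n ω))
    (z : A 0 ⊗[ℂ] ⋀[ℂ]^0 (Fin r → ℂ)) :
    koszulHomotopy D 0 (δ 0 z) = (∑ i, D 0 i ∘ₗ T 0 i).rTensor _ z := by
  induction z with
  | zero => simp
  | add x y hx hy => simp only [map_add, hx, hy]
  | tmul x ω =>
    simp only [hδ, map_sum, koszulHomotopy_tmul, contractionMap_wedgeMap_zero,
      LinearMap.rTensor_tmul, LinearMap.sum_apply, sum_tmul, LinearMap.comp_apply,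
      LinearMap.proj_apply]
    refine Finset.sum_congr rfl fun j _ => ?_
    rw [Finset.sum_eq_single j]
    · simp
    · intro i _ hij
      rw [Pi.single_eq_of_ne hij, zero_smul, tmul_zero]
    · simp

theorem koszulHomotopy_differential_succ
    (hδ : ∀ (n : ℕ) (x : A n) (ω : ⋀[ℂ]^n (Fin r → ℂ)),
      δ n (x ⊗ₜ[ℂ] ω) = ∑ i, (T n i x) ⊗ₜ[ℂ] (wedgeMap ℂ (Pi.single i 1) n ω))
    (hDT : ∀ n i j x, D (n + 1) i (T (n + 1) j x) = T n j (D n i x) + if i = j then x else 0)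
    (n : ℕ) (z : A (n + 1) ⊗[ℂ] ⋀[ℂ]^(n + 1) (Fin r → ℂ)) :
    δ n (koszulHomotopy D n z) + koszulHomotopy D (n + 1) (δ (n + 1) z) =
      (∑ i, D (n + 1) i ∘ₗ T (n + 1) i).rTensor _ z - ((n + 1 : ℕ) : ℂ) • z := by
  induction z with
  | zero => simp
  | add x y hx hy =>
    simp only [map_add, smul_add]
    rw [add_add_add_comm, hx, hy]
    abel
  | tmul x ω =>
    rw [← tmul_smul, ← sum_wedgeMap_contractionMap, tmul_sum]
    simp only [hδ, map_sum, koszulHomotopy_tmul, contractionMap_wedgeMap_succ,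
      LinearMap.rTensor_tmul, LinearMap.sum_apply, sum_tmul, LinearMap.comp_apply,
      LinearMap.proj_apply]
    rw [Finset.sum_comm, ← Finset.sum_add_distrib, ← Finset.sum_sub_distrib]
    refine Finset.sum_congr rfl fun j _ => ?_
    rw [← Finset.sum_add_distrib, Finset.sum_eq_single j]
    · rw [hDT]
      simp only [if_true, Pi.single_eq_same, one_smul, tmul_sub, add_tmul]
      abel
    · intro i _ hij
      rw [hDT, if_neg hij, Pi.single_eq_of_ne hij, zero_smul, zero_sub, tmul_neg, add_zero,
        add_neg_cancel]
    · simp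

theorem differential_comp_differential
    (hδ : ∀ (n : ℕ) (x : A n) (ω : ⋀[ℂ]^n (Fin r → ℂ)),
      δ n (x ⊗ₜ[ℂ] ω) = ∑ i, (T n i x) ⊗ₜ[ℂ] (wedgeMap ℂ (Pi.single i 1) n ω))
    (hTT : ∀ n i j x, T (n + 1) i (T n j x) = T (n + 1) j (T n i x))
    (n : ℕ) (z : A n ⊗[ℂ] ⋀[ℂ]^n (Fin r → ℂ)) : δ (n + 1) (δ n z) = 0 := by
  induction z with
  | zero => simp
  | add x y hx hy => rw [map_add, map_add, hx, hy, add_zero]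
  | tmul x ω =>
    simp only [hδ, map_sum]
    have hanti : ∀ i j : Fin r,
        wedgeMap ℂ (Pi.single i (1 : ℂ)) (n + 1) (wedgeMap ℂ (Pi.single j 1) n ω) =
        - wedgeMap ℂ (Pi.single j (1 : ℂ)) (n + 1) (wedgeMap ℂ (Pi.single i 1) n ω) := by
      intro i j
      apply Subtype.ext
      change ExteriorAlgebra.ι ℂ (Pi.single i (1 : ℂ) : Fin r → ℂ) *
          (ExteriorAlgebra.ι ℂ (Pi.single j (1 : ℂ) : Fin r → ℂ) * _) =
        - (ExteriorAlgebra.ι ℂ (Pi.single j (1 : ℂ) : Fin r → ℂ) *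
          (ExteriorAlgebra.ι ℂ (Pi.single i (1 : ℂ) : Fin r → ℂ) * _))
      rw [← mul_assoc, ← mul_assoc, ← neg_mul]
      exact congrArg (· * _)
        (eq_neg_of_add_eq_zero_left (ExteriorAlgebra.ι_add_mul_swap _ _))
    have : IsAddTorsionFree (A (n + 1 + 1) ⊗[ℂ] ⋀[ℂ]^(n + 1 + 1) (Fin r → ℂ)) :=
      .of_isTorsionFree ℂ _
    refine self_eq_neg.1 ?_
    simp only [← Finset.sum_neg_distrib]
    rw [Finset.sum_comm]
    refine Finset.sum_congr rfl fun i _ => Finset.sum_congr rfl fun j _ => ?_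
    rw [hTT n i j, hanti i j, tmul_neg]

/-- Exactness of a Koszul complex whose Euler operator `Σᵢ Dᵢ Tᵢ` in degree `n` is
`a + n` up to a locally nilpotent operator, with `a ≠ 0`. -/
theorem koszul_exact {a : ℂ} (ha : a ≠ 0)
    (hδ : ∀ (n : ℕ) (x : A n) (ω : ⋀[ℂ]^n (Fin r → ℂ)),
      δ n (x ⊗ₜ[ℂ] ω) = ∑ i, (T n i x) ⊗ₜ[ℂ] (wedgeMap ℂ (Pi.single i 1) n ω))
    (hTT : ∀ n i j x, T (n + 1) i (T n j x) = T (n + 1) j (T n i x))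
    (hDT : ∀ n i j x, D (n + 1) i (T (n + 1) j x) = T n j (D n i x) + if i = j then x else 0)
    (hN : ∀ n x, ∃ m : ℕ,
      (((∑ i, D n i ∘ₗ T n i : Module.End ℂ (A n)) - (a + n) • 1) ^ m) x = 0) :
    LinearMap.ker (δ 0) = ⊥ ∧ ∀ n : ℕ, LinearMap.ker (δ (n + 1)) = LinearMap.range (δ n) := by
  have hsplit : ∀ n (z : A n ⊗[ℂ] ⋀[ℂ]^n (Fin r → ℂ)),
      ((∑ i, D n i ∘ₗ T n i : Module.End ℂ (A n)) - (a + n) • 1).rTensor _ z + a • z =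
      (∑ i, D n i ∘ₗ T n i : Module.End ℂ (A n)).rTensor _ z - (n : ℂ) • z := by
    intro n z
    rw [LinearMap.rTensor_sub, LinearMap.rTensor_smul, LinearMap.sub_apply,
      LinearMap.smul_apply, Module.End.one_eq_id, LinearMap.rTensor_id, LinearMap.id_apply,
      add_smul]
    abel
  constructor
  · rw [eq_bot_iff]
    intro z hz
    obtain ⟨m, hm⟩ := exists_rTensor_pow_eq_zero _ (hN 0) z
    refine mem_of_nilpotent_add_smul (K := LinearMap.ker (δ 0)) bot_le ha
      (fun x hx => ?_) m z hz hm
    rw [Submodule.mem_bot, hsplit, ← koszulHomotopy_differential_zero hδ,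
      LinearMap.mem_ker.1 hx]
    simp
  · intro n
    have hle : LinearMap.range (δ n) ≤ LinearMap.ker (δ (n + 1)) := by
      rintro _ ⟨z, rfl⟩
      exact differential_comp_differential hδ hTT n z
    refine le_antisymm (fun z hz => ?_) hle
    obtain ⟨m, hm⟩ := exists_rTensor_pow_eq_zero _ (hN (n + 1)) z
    refine mem_of_nilpotent_add_smul hle ha (fun x hx => ?_) m z hz hm
    rw [hsplit, ← koszulHomotopy_differential_succ hδ hDT, LinearMap.mem_ker.1 hx, map_zero,
      add_zero]
    exact LinearMap.mem_range_self _ _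

end Koszul

/-- Let `M` be a complex vector space with a rank-`r` Weyl system
`t_1, …, t_r, ∂_1, …, ∂_r`, `θ := Σᵢ tᵢ ∘ ∂ᵢ`, and `(V^χ)_χ` an abstract V-filtration.
Then for every rational `α ≠ 0` the Koszul-type complex `B^α` with `ℓ`-th term
`gr^{α+ℓ}(M) ⊗ Λ^ℓ(ℂ^r)` (for `ℓ = 0, …, r`, extended by zero spaces beyond `r`) and
differential induced by `m ⊗ ω ↦ Σᵢ tᵢ(m) ⊗ (eᵢ ∧ ω)` is exact (here `T n i` is the map
`gr^{α+n} → gr^{α+n+1}` induced by `tᵢ` and `δ n` is the Koszul differential; exactness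
is expressed as `ker (δ 0) = 0`, i.e. injectivity at the leftmost spot, together with
`ker (δ (n+1)) = range (δ n)` for all `n`, which at `n = r-1` is surjectivity onto the
rightmost term since the `(r+1)`-st term vanishes). -/
theorem statement2 (r : ℕ) (hr : 1 ≤ r)
    (M : Type*) [AddCommGroup M] [Module ℂ M]
    (t d : Fin r → Module.End ℂ M)
    (htt : ∀ i j, t i * t j = t j * t i)
    (hdd : ∀ i j, d i * d j = d j * d i)
    (hdt : ∀ i j, d i * t j - t j * d i = if i = j then 1 else 0)
    (θ : Module.End ℂ M) (hθ : θ = ∑ i, t i * d i)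
    (V : ℚ → Submodule ℂ M)
    (hmono : ∀ ⦃χ χ' : ℚ⦄, χ ≤ χ' → V χ' ≤ V χ)
    (hVt : ∀ (i : Fin r) (χ : ℚ), ∀ m ∈ V χ, t i m ∈ V (χ + 1))
    (hVd : ∀ (i : Fin r) (χ : ℚ), ∀ m ∈ V χ, d i m ∈ V (χ - 1))
    (hVnil : ∀ (χ : ℚ), ∀ m ∈ V χ, ∃ k : ℕ, 1 ≤ k ∧
      (((θ - ((χ : ℂ) - (r : ℂ)) • 1) ^ k) m ∈ Vgt V χ))
    (α : ℚ) (hα : α ≠ 0)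
    (T : ∀ (n : ℕ), Fin r → (Gr V (α + n) →ₗ[ℂ] Gr V (α + (n + 1 : ℕ))))
    (hT : ∀ (n : ℕ) (i : Fin r) (m : M) (hm : m ∈ V (α + n))
        (hm' : t i m ∈ V (α + (n + 1 : ℕ))),
      T n i (Submodule.Quotient.mk ⟨m, hm⟩) = Submodule.Quotient.mk ⟨t i m, hm'⟩)
    (δ : ∀ n : ℕ, (Gr V (α + n) ⊗[ℂ] ⋀[ℂ]^n (Fin r → ℂ)) →ₗ[ℂ]
        (Gr V (α + (n + 1 : ℕ)) ⊗[ℂ] ⋀[ℂ]^(n+1) (Fin r → ℂ)))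
    (hδ : ∀ (n : ℕ) (x : Gr V (α + n)) (ω : ⋀[ℂ]^n (Fin r → ℂ)),
      δ n (x ⊗ₜ[ℂ] ω) = ∑ i, (T n i x) ⊗ₜ[ℂ] (wedgeMap ℂ (Pi.single i 1) n ω)) :
    LinearMap.ker (δ 0) = ⊥ ∧
    ∀ n : ℕ, LinearMap.ker (δ (n+1)) = LinearMap.range (δ n) := by
  have hVd' : ∀ (i : Fin r) (χ : ℚ), ∀ m ∈ V χ, d i m ∈ V (χ + (-1)) := fun i χ m hm => by
    simpa [sub_eq_add_neg] using hVd i χ m hm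
  have hup : ∀ n : ℕ, α + n + 1 = α + (n + 1 : ℕ) := fun n => by push_cast; ring
  have hdown : ∀ n : ℕ, α + (n + 1 : ℕ) + (-1) = α + n := fun n => by push_cast; ring
  have htm : ∀ (n : ℕ) (i : Fin r) (m : M), m ∈ V (α + n) → t i m ∈ V (α + (n + 1 : ℕ)) :=
    fun n i m hm => hup n ▸ hVt i _ m hm
  have hdm : ∀ (n : ℕ) (i : Fin r) (m : M), m ∈ V (α + (n + 1 : ℕ)) → d i m ∈ V (α + n) :=
    fun n i m hm => by simpa only [hdown n] using hVd' i _ m hm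
  choose D hD using fun (n : ℕ) (i : Fin r) => exists_grMap V (hVd' i) _ _ (hdown n)
  have hcomm : ∀ (i j : Fin r) (m : M), d i (t j m) = t j (d i m) + if i = j then m else 0 := by
    intro i j m
    have h := LinearMap.congr_fun (hdt i j) m
    rw [LinearMap.sub_apply, sub_eq_iff_eq_add] at h
    rw [Module.End.mul_apply, Module.End.mul_apply] at h
    rw [h, add_comm]
    split_ifs <;> simp
  have hαℂ : (α : ℂ) ≠ 0 := by exact_mod_cast hα
  refine koszul_exact (A := fun n => Gr V (α + n)) (T := T) (D := D) hαℂ hδ ?_ ?_ ?_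
  · intro n i j x
    obtain ⟨⟨m, hm⟩, rfl⟩ := Submodule.Quotient.mk_surjective _ x
    rw [hT n j m hm (htm n j m hm), hT n i m hm (htm n i m hm),
      hT (n + 1) i _ _ (htm _ i _ (htm n j m hm)), hT (n + 1) j _ _ (htm _ j _ (htm n i m hm))]
    congr 2
    exact LinearMap.congr_fun (htt i j) m
  · intro n i j x
    obtain ⟨⟨m, hm⟩, rfl⟩ := Submodule.Quotient.mk_surjective _ x
    rw [hT (n + 1) j m hm (htm _ j m hm), hD n i m hm (hdm n i m hm),
      hD (n + 1) i _ _ (hdm _ i _ (htm _ j m hm)), hT n j _ _ (htm _ j _ (hdm n i m hm))]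
    split_ifs with hij
    · rw [← Submodule.Quotient.mk_add]
      congr 1
      exact Subtype.ext (by simpa [hij] using hcomm i j m)
    · rw [add_zero]
      congr 1
      exact Subtype.ext (by simpa [hij] using hcomm i j m)
  · intro n x
    set N : Module.End ℂ (Gr V (α + n)) :=
      (∑ i, D n i ∘ₗ T n i) - ((α : ℂ) + n) • 1 with hNdef
    set P : Module.End ℂ M := θ - (((α + n : ℚ) : ℂ) - (r : ℂ)) • 1 with hPdef
    have hP : ∀ m, P m = ∑ i, d i (t i m) - ((α : ℂ) + n) • m := by
      intro m
      simp only [hcomm, if_true, Finset.sum_add_distrib, Finset.sum_const, Finset.card_univ,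
        Fintype.card_fin, hPdef, hθ, LinearMap.sub_apply, LinearMap.sum_apply,
        Module.End.mul_apply, LinearMap.smul_apply, Module.End.one_apply]
      push_cast
      rw [← Nat.cast_smul_eq_nsmul ℂ]
      module
    have hPm : ∀ m ∈ V (α + n), P m ∈ V (α + n) := fun m hm => by
      rw [hP]
      exact Submodule.sub_mem _ (Submodule.sum_mem _ fun i _ => hdm n i _ (htm n i m hm))
        (Submodule.smul_mem _ _ hm)
    have hN1 : ∀ (m : M) (hm : m ∈ V (α + n)),
        N (Submodule.Quotient.mk ⟨m, hm⟩) = Submodule.Quotient.mk ⟨P m, hPm m hm⟩ := by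
      intro m hm
      have hsum : (⟨P m, hPm m hm⟩ : V (α + n)) =
          ∑ i, (⟨d i (t i m), hdm n i _ (htm n i m hm)⟩ : V (α + n)) -
            ((α : ℂ) + n) • ⟨m, hm⟩ := by
        apply Subtype.ext
        simp [hP]
      rw [hsum, Submodule.Quotient.mk_sub, Submodule.Quotient.mk_smul, hNdef,
        LinearMap.sub_apply, LinearMap.sum_apply]
      refine congrArg₂ _ (Eq.trans ?_ (map_sum (Submodule.mkQ _) _ _).symm) rfl
      refine Finset.sum_congr rfl fun i _ => ?_
      rw [LinearMap.comp_apply, hT n i m hm (htm n i m hm), hD n i _ _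
        (hdm n i _ (htm n i m hm)), Submodule.mkQ_apply]
    have hNk : ∀ (k : ℕ) (m : M) (hm : m ∈ V (α + n)), ∃ hk : (P ^ k) m ∈ V (α + n),
        (N ^ k) (Submodule.Quotient.mk ⟨m, hm⟩) = Submodule.Quotient.mk ⟨(P ^ k) m, hk⟩ := by
      intro k
      induction k with
      | zero => exact fun m hm => ⟨hm, rfl⟩
      | succ k ih =>
        intro m hm
        obtain ⟨hk, h⟩ := ih (P m) (hPm m hm)
        exact ⟨hk, by rw [pow_succ, Module.End.mul_apply, hN1, h]; rfl⟩
    obtain ⟨⟨m, hm⟩, rfl⟩ := Submodule.Quotient.mk_surjective _ x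
    obtain ⟨k, -, hk⟩ := hVnil _ m hm
    obtain ⟨hk', h⟩ := hNk k m hm
    refine ⟨k, h.trans ?_⟩
    rw [Submodule.Quotient.mk_eq_zero]
    exact hk
end
end

section
/- Let M be a complex vector space equipped with a rank-r Weyl system t_1,…,t_r, ∂_1,…,∂_r, set θ := Σ_{i=1}^r t_i∘∂_i, and let (V^χ)_{χ∈ℚ} be an abstract V-filtration on M. Then for every rational number α ≠ 0 the Koszul-type complex C^α, whose ℓ-th term (ℓ = 0,…,r) is gr^{α+r−ℓ}(M) ⊗ Λ^ℓ(ℂ^r) and whose differential is induced by m⊗ω ↦ Σ_{i=1}^r ∂_i(m)⊗(e_i∧ω), is exact. -/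
open TensorProduct

noncomputable section

section ExteriorContraction

variable {R M : Type*} [CommRing R] [AddCommGroup M] [Module R M]

@[simp]
theorem coe_wedgeMap (v : M) (n : ℕ) (ω : ⋀[R]^n M) :
    (wedgeMap R v n ω : ExteriorAlgebra R M) = ExteriorAlgebra.ι R v * ω := rfl

theorem wedgeMap_wedgeMap_self (v : M) (n : ℕ) (ω : ⋀[R]^n M) :
    wedgeMap R v (n + 1) (wedgeMap R v n ω) = 0 := by
  ext
  simp [← mul_assoc]

theorem wedgeMap_wedgeMap_swap (v w : M) (n : ℕ) (ω : ⋀[R]^n M) :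
    wedgeMap R v (n + 1) (wedgeMap R w n ω) = -wedgeMap R w (n + 1) (wedgeMap R v n ω) := by
  ext
  simp only [coe_wedgeMap, ← mul_assoc, NegMemClass.coe_neg]
  rw [eq_neg_of_add_eq_zero_left (ExteriorAlgebra.ι_add_mul_swap v w), neg_mul]

/-- Contraction of an element of the exterior algebra with a linear form. -/
def extContract (φ : Module.Dual R M) : ExteriorAlgebra R M →ₗ[R] ExteriorAlgebra R M :=
  CliffordAlgebra.contractLeft (Q := (0 : QuadraticForm R M)) φ

theorem extContract_ι_mul (φ : Module.Dual R M) (v : M) (x : ExteriorAlgebra R M) :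
    extContract φ (ExteriorAlgebra.ι R v * x) =
      φ v • x - ExteriorAlgebra.ι R v * extContract φ x :=
  CliffordAlgebra.contractLeft_ι_mul φ v x

theorem extContract_of_mem_zero (φ : Module.Dual R M) {x : ExteriorAlgebra R M}
    (hx : x ∈ ⋀[R]^0 M) : extContract φ x = 0 := by
  change x ∈ LinearMap.range (ExteriorAlgebra.ι R : M →ₗ[R] _) ^ 0 at hx
  rw [pow_zero, Submodule.mem_one] at hx
  obtain ⟨c, rfl⟩ := hx
  exact CliffordAlgebra.contractLeft_algebraMap _ φ c

theorem exteriorPower_succ_induction {n : ℕ}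
    {p : ∀ x : ExteriorAlgebra R M, x ∈ ⋀[R]^(n + 1) M → Prop}
    (ι_mul : ∀ (v : M) (x) (hx : x ∈ ⋀[R]^n M),
      p (ExteriorAlgebra.ι R v * x) (wedgeMap R v n ⟨x, hx⟩).2)
    (add : ∀ x y hx hy, p x hx → p y hy → p (x + y) (add_mem hx hy))
    {x : ExteriorAlgebra R M} (hx : x ∈ ⋀[R]^(n + 1) M) : p x hx := by
  have hx' : x ∈ LinearMap.range (ExteriorAlgebra.ι R : M →ₗ[R] _) *
      LinearMap.range (ExteriorAlgebra.ι R : M →ₗ[R] _) ^ n := by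
    rw [← pow_succ']
    exact hx
  suffices ∃ h, p x h from this.2
  refine Submodule.mul_induction_on hx' ?_ fun x y ⟨hx, px⟩ ⟨hy, py⟩ =>
    ⟨add_mem hx hy, add x y hx hy px py⟩
  rintro _ ⟨v, rfl⟩ y hy
  exact ⟨_, ι_mul v y hy⟩

theorem extContract_mem (φ : Module.Dual R M) (n : ℕ) {x : ExteriorAlgebra R M}
    (hx : x ∈ ⋀[R]^(n + 1) M) : extContract φ x ∈ ⋀[R]^n M := by
  induction n generalizing x with
  | zero =>
    induction hx using exteriorPower_succ_induction with
    | ι_mul v y hy =>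
      rw [extContract_ι_mul, extContract_of_mem_zero φ hy, mul_zero, sub_zero]
      exact Submodule.smul_mem _ _ hy
    | add x y _ _ hx hy =>
      rw [map_add]
      exact add_mem hx hy
  | succ n ih =>
    induction hx using exteriorPower_succ_induction with
    | ι_mul v y hy =>
      rw [extContract_ι_mul]
      exact sub_mem (Submodule.smul_mem _ _ hy) (wedgeMap R v n ⟨_, ih hy⟩).2
    | add x y _ _ hx hy =>
      rw [map_add]
      exact add_mem hx hy

/-- Contraction with a linear form, as a map `⋀^(n+1) M → ⋀^n M`. -/
def contractMap (φ : Module.Dual R M) (n : ℕ) : ⋀[R]^(n + 1) M →ₗ[R] ⋀[R]^n M :=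
  (extContract φ).restrict fun _ hx => extContract_mem φ n hx

@[simp]
theorem coe_contractMap (φ : Module.Dual R M) (n : ℕ) (ω : ⋀[R]^(n + 1) M) :
    (contractMap φ n ω : ExteriorAlgebra R M) = extContract φ ω := rfl

theorem contractMap_wedgeMap_zero (φ : Module.Dual R M) (v : M) (ω : ⋀[R]^0 M) :
    contractMap φ 0 (wedgeMap R v 0 ω) = φ v • ω := by
  ext
  simp [extContract_ι_mul, extContract_of_mem_zero φ ω.2]

theorem contractMap_wedgeMap_succ (φ : Module.Dual R M) (v : M) (n : ℕ) (ω : ⋀[R]^(n + 1) M) :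
    contractMap φ (n + 1) (wedgeMap R v (n + 1) ω) =
      φ v • ω - wedgeMap R v n (contractMap φ n ω) := by
  ext
  simp [extContract_ι_mul]

variable {ι : Type*} [Fintype ι] [DecidableEq ι]

theorem sum_ι_mul_extContract (n : ℕ) {x : ExteriorAlgebra R (ι → R)}
    (hx : x ∈ ⋀[R]^n (ι → R)) :
    ∑ i, ExteriorAlgebra.ι R (Pi.single i (1 : R) : ι → R) *
      extContract (LinearMap.proj i) x = (n : R) • x := by
  induction n generalizing x with
  | zero => simp [extContract_of_mem_zero _ hx]
  | succ n ih =>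
    induction hx using exteriorPower_succ_induction with
    | ι_mul v y hy =>
      have hv : ∑ i, v i • ExteriorAlgebra.ι R (Pi.single i (1 : R) : ι → R) =
          ExteriorAlgebra.ι R v := by
        conv_rhs => rw [pi_eq_sum_univ' v]
        simp only [map_sum, map_smul]
      have hsw (w : ι → R) (z : ExteriorAlgebra R (ι → R)) :
          ExteriorAlgebra.ι R w * (ExteriorAlgebra.ι R v * z) =
            -(ExteriorAlgebra.ι R v * (ExteriorAlgebra.ι R w * z)) := by
        rw [← mul_assoc, eq_neg_of_add_eq_zero_left (ExteriorAlgebra.ι_add_mul_swap w v),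
          neg_mul, mul_assoc]
      simp only [extContract_ι_mul, mul_sub, hsw, sub_neg_eq_add, Finset.sum_add_distrib,
        LinearMap.proj_apply, mul_smul_comm, ← Finset.mul_sum, ih hy]
      simp only [← smul_mul_assoc, ← Finset.sum_mul, hv]
      simp only [smul_mul_assoc]
      push_cast
      module
    | add x y _ _ hx hy =>
      simp only [map_add, mul_add, Finset.sum_add_distrib, hx, hy, smul_add]

theorem sum_wedgeMap_contractMap (n : ℕ) (ω : ⋀[R]^(n + 1) (ι → R)) :
    ∑ i, wedgeMap R (Pi.single i (1 : R) : ι → R) n (contractMap (LinearMap.proj i) n ω) =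
      ((n + 1 : ℕ) : R) • ω := by
  ext
  simpa using sum_ι_mul_extContract (n + 1) ω.2

end ExteriorContraction

section Koszul

theorem mem_of_sub_smul_pow_apply_mem {K E : Type*} [Field K] [AddCommGroup E] [Module K E]
    (f : Module.End K E) (W : Submodule K E) (hW : ∀ x ∈ W, f x ∈ W) {a : K} (ha : a ≠ 0)
    (k : ℕ) {x : E} (hx : f x ∈ W) (hk : ((f - a • 1) ^ k) x ∈ W) : x ∈ W := by
  induction k generalizing x with
  | zero => simpa using hk
  | succ k ih =>
    rw [pow_succ, Module.End.mul_apply] at hk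
    have h : (f - a • 1) x ∈ W := by
      refine ih ?_ hk
      have : f ((f - a • 1) x) = f (f x) - a • f x := by simp
      rw [this]
      exact sub_mem (hW _ hx) (W.smul_mem _ hx)
    have h' : a • x ∈ W := by
      have : a • x = f x - (f - a • 1) x := by simp
      rw [this]
      exact sub_mem hx h
    exact (W.smul_mem_iff ha).1 h'

theorem exists_pow_rTensor_apply_eq_zero {K E F : Type*} [CommRing K] [AddCommGroup E]
    [Module K E] [AddCommGroup F] [Module K F] (f : Module.End K E)
    (hf : ∀ x, ∃ k : ℕ, (f ^ k) x = 0) (z : E ⊗[K] F) :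
    ∃ k : ℕ, ((f.rTensor F : Module.End K (E ⊗[K] F)) ^ k) z = 0 := by
  induction z with
  | zero => exact ⟨0, map_zero _⟩
  | tmul x y =>
    obtain ⟨k, hk⟩ := hf x
    refine ⟨k, ?_⟩
    have h : ((f.rTensor F : Module.End K (E ⊗[K] F)) ^ k) = (f ^ k).rTensor F :=
      LinearMap.rTensor_pow f k
    rw [h, LinearMap.rTensor_tmul, hk, TensorProduct.zero_tmul]
  | add x y hx hy =>
    obtain ⟨k, hk⟩ := hx
    obtain ⟨l, hl⟩ := hy
    refine ⟨k + l, ?_⟩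
    rw [map_add, pow_add, Module.End.mul_apply, Module.End.mul_apply, hl, map_zero, add_zero,
      ← Module.End.mul_apply, ← pow_add, add_comm k l, pow_add, Module.End.mul_apply, hk,
      map_zero]

variable {K ι : Type*} [Field K] [Fintype ι] {G : ℕ → Type*}
  [∀ n, AddCommGroup (G n)] [∀ n, Module K (G n)]

/-- The contracting operator `x ⊗ ω ↦ ∑ i, T i x ⊗ (e i^* ⌟ ω)`. -/
def koszulH (T : ∀ n, ι → G (n + 1) →ₗ[K] G n) (n : ℕ) :
    G (n + 1) ⊗[K] ⋀[K]^(n + 1) (ι → K) →ₗ[K] G n ⊗[K] ⋀[K]^n (ι → K) :=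
  ∑ i, TensorProduct.map (T n i) (contractMap (LinearMap.proj i) n)

theorem koszulH_tmul (T : ∀ n, ι → G (n + 1) →ₗ[K] G n) (n : ℕ)
    (x : G (n + 1)) (ω : ⋀[K]^(n + 1) (ι → K)) :
    koszulH T n (x ⊗ₜ ω) = ∑ i, T n i x ⊗ₜ contractMap (LinearMap.proj i) n ω := by
  simp [koszulH, LinearMap.sum_apply]

variable [DecidableEq ι]

/-- The Koszul-type differential `x ⊗ ω ↦ ∑ i, D i x ⊗ (e i ∧ ω)`. -/
def koszulD (D : ∀ n, ι → G n →ₗ[K] G (n + 1)) (n : ℕ) :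
    G n ⊗[K] ⋀[K]^n (ι → K) →ₗ[K] G (n + 1) ⊗[K] ⋀[K]^(n + 1) (ι → K) :=
  ∑ i, TensorProduct.map (D n i) (wedgeMap K (Pi.single i 1) n)

variable (D : ∀ n, ι → G n →ₗ[K] G (n + 1)) (T : ∀ n, ι → G (n + 1) →ₗ[K] G n)

theorem koszulD_tmul (n : ℕ) (x : G n) (ω : ⋀[K]^n (ι → K)) :
    koszulD D n (x ⊗ₜ ω) = ∑ i, D n i x ⊗ₜ wedgeMap K (Pi.single i 1) n ω := by
  simp [koszulD, LinearMap.sum_apply]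

/-- The Euler operator `∑ i, T i ∘ D i`. -/
def eulerOp (n : ℕ) : Module.End K (G n) := ∑ i, T n i ∘ₗ D n i

theorem koszulD_koszulD (hDD : ∀ n i j x, D (n + 1) i (D n j x) = D (n + 1) j (D n i x))
    (n : ℕ) (z : G n ⊗[K] ⋀[K]^n (ι → K)) : koszulD D (n + 1) (koszulD D n z) = 0 := by
  induction z with
  | zero => simp
  | add x y hx hy => simp [hx, hy]
  | tmul x ω =>
    simp only [koszulD_tmul, map_sum]
    rw [← Finset.sum_product']
    refine Finset.sum_involution (fun p _ => p.swap) ?_ ?_ ?_ ?_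
    · rintro ⟨i, j⟩ -
      simp only [Prod.swap]
      rw [hDD n i j, wedgeMap_wedgeMap_swap (Pi.single i 1) (Pi.single j 1), TensorProduct.tmul_neg,
        add_neg_eq_zero.2 rfl]
    · rintro ⟨i, j⟩ - h heq
      obtain rfl : j = i := congrArg Prod.fst heq
      exact h (by simp [wedgeMap_wedgeMap_self])
    · simp
    · simp

theorem koszulH_koszulD_zero (z : G 0 ⊗[K] ⋀[K]^0 (ι → K)) :
    koszulH T 0 (koszulD D 0 z) = (eulerOp D T 0).rTensor _ z := by
  induction z with
  | zero => simp
  | add x y hx hy => simp only [map_add, hx, hy]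
  | tmul x ω =>
    simp [koszulD_tmul, koszulH_tmul, contractMap_wedgeMap_zero, eulerOp, Pi.single_apply,
      ite_smul, TensorProduct.tmul_ite, TensorProduct.sum_tmul]

theorem koszulH_koszulD_add (hDT : ∀ n i j x,
      D n i (T n j x) = T (n + 1) j (D (n + 1) i x) + if i = j then x else 0)
    (n : ℕ) (z : G (n + 1) ⊗[K] ⋀[K]^(n + 1) (ι → K)) :
    koszulH T (n + 1) (koszulD D (n + 1) z) + koszulD D n (koszulH T n z) =
      (eulerOp D T (n + 1) + ((n + 1 : ℕ) : K) • 1).rTensor _ z := by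
  induction z with
  | zero => simp
  | add x y hx hy =>
    simp only [map_add]
    rw [← hx, ← hy]
    abel
  | tmul x ω =>
    simp only [koszulD_tmul, koszulH_tmul, map_sum, contractMap_wedgeMap_succ, hDT,
      TensorProduct.add_tmul, TensorProduct.tmul_sub, Finset.sum_add_distrib,
      Finset.sum_sub_distrib]
    rw [Finset.sum_comm (f := fun i j => T (n + 1) j (D (n + 1) i x) ⊗ₜ[K]
      wedgeMap K (Pi.single i (1 : K) : ι → K) n (contractMap (LinearMap.proj j) n ω))]
    have hE := sum_wedgeMap_contractMap (R := K) n ω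
    have h1 : ∑ i, x ⊗ₜ[K] wedgeMap K (Pi.single i (1 : K) : ι → K) n
        (contractMap (LinearMap.proj i) n ω) = ((n + 1 : ℕ) : K) • (x ⊗ₜ[K] ω) := by
      rw [← TensorProduct.tmul_sum, hE, TensorProduct.tmul_smul]
    simp only [LinearMap.proj_apply, Pi.single_apply, ite_smul, one_smul, zero_smul,
      TensorProduct.tmul_ite, TensorProduct.ite_tmul, Finset.sum_ite_eq', Finset.mem_univ, if_true,
      h1, LinearMap.rTensor_tmul, eulerOp, LinearMap.add_apply, LinearMap.sum_apply,
      LinearMap.comp_apply, LinearMap.smul_apply, Module.End.one_apply,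
      TensorProduct.add_tmul, TensorProduct.sum_tmul, TensorProduct.smul_tmul']
    abel

theorem koszulD_exact
    (hDD : ∀ n i j x, D (n + 1) i (D n j x) = D (n + 1) j (D n i x))
    (hDT : ∀ n i j x,
      D n i (T n j x) = T (n + 1) j (D (n + 1) i x) + if i = j then x else 0)
    {a : K} (ha : a ≠ 0)
    (hnil : ∀ n (x : G n), ∃ k : ℕ, ((eulerOp D T n - (a - (n : K)) • 1) ^ k) x = 0) :
    LinearMap.ker (koszulD D 0) = ⊥ ∧
      ∀ n, LinearMap.ker (koszulD D (n + 1)) = LinearMap.range (koszulD D n) := by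
  have hnil' (n : ℕ) (z : G n ⊗[K] ⋀[K]^n (ι → K)) :
      ∃ k : ℕ, (((eulerOp D T n + (n : K) • 1).rTensor (⋀[K]^n (ι → K)) - a • 1 :
        Module.End K (G n ⊗[K] ⋀[K]^n (ι → K))) ^ k) z = 0 := by
    obtain ⟨k, hk⟩ := exists_pow_rTensor_apply_eq_zero _ (hnil n) z
    refine ⟨k, ?_⟩
    rw [← hk]
    congr 2
    refine TensorProduct.ext' fun x ω => ?_
    simp only [LinearMap.rTensor_tmul, LinearMap.sub_apply, LinearMap.add_apply,
      LinearMap.smul_apply, Module.End.one_apply, TensorProduct.smul_tmul',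
      ← TensorProduct.sub_tmul]
    congr 1
    module
  constructor
  · rw [eq_bot_iff]
    intro z hz
    obtain ⟨k, hk⟩ := hnil' 0 z
    refine mem_of_sub_smul_pow_apply_mem _ _ (by simp) ha k ?_ ((Submodule.mem_bot K).2 hk)
    have := koszulH_koszulD_zero D T z
    rw [LinearMap.mem_ker.1 hz, map_zero] at this
    simpa using this.symm
  · intro n
    apply le_antisymm
    · intro z hz
      have key (w) (hw : koszulD D (n + 1) w = 0) :
          (eulerOp D T (n + 1) + ((n + 1 : ℕ) : K) • 1).rTensor _ w ∈
            LinearMap.range (koszulD D n) := by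
        rw [← koszulH_koszulD_add D T hDT, hw, map_zero, zero_add]
        exact LinearMap.mem_range_self _ _
      obtain ⟨k, hk⟩ := hnil' (n + 1) z
      refine mem_of_sub_smul_pow_apply_mem _ _ ?_ ha k (key z hz) ?_
      · rintro _ ⟨y, rfl⟩
        exact key _ (koszulD_koszulD D hDD n y)
      · rw [hk]
        exact zero_mem _
    · rintro _ ⟨y, rfl⟩
      exact koszulD_koszulD D hDD n y

end Koszul

section Graded

variable {M : Type*} [AddCommGroup M] [Module ℂ M] {V : ℚ → Submodule ℂ M}

theorem Vgt_le_comap {f : Module.End ℂ M} {c : ℚ} (hf : ∀ χ, ∀ m ∈ V χ, f m ∈ V (χ + c))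
    {χ χ' : ℚ} (h : χ' = χ + c) : Vgt V χ ≤ (Vgt V χ').comap f := by
  refine iSup₂_le fun β hβ m hm => ?_
  have hβ' : χ' < β + c := by
    rw [h]
    gcongr
  exact Submodule.mem_iSup_of_mem (β + c) (Submodule.mem_iSup_of_mem hβ' (hf β m hm))

/-- The map `gr^χ(M) → gr^χ'(M)`, `χ' = χ + c`, induced by an endomorphism of degree `c`. -/
def grMap (f : Module.End ℂ M) {c : ℚ} (hf : ∀ χ, ∀ m ∈ V χ, f m ∈ V (χ + c))
    {χ χ' : ℚ} (h : χ' = χ + c) : Gr V χ →ₗ[ℂ] Gr V χ' :=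
  Submodule.mapQ _ _ (f.restrict fun m hm => h ▸ hf χ m hm)
    fun _ hx => Vgt_le_comap hf h hx

theorem grMap_mk (f : Module.End ℂ M) {c : ℚ} (hf : ∀ χ, ∀ m ∈ V χ, f m ∈ V (χ + c))
    {χ χ' : ℚ} (h : χ' = χ + c) (m : M) (hm : m ∈ V χ) :
    grMap f hf h (Submodule.Quotient.mk ⟨m, hm⟩) =
      Submodule.Quotient.mk ⟨f m, h ▸ hf χ m hm⟩ := rfl

theorem pow_apply_Gr_mk {χ : ℚ} (F : Module.End ℂ (Gr V χ)) (f : Module.End ℂ M)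
    (hf : ∀ m ∈ V χ, f m ∈ V χ)
    (hF : ∀ m (hm : m ∈ V χ),
      F (Submodule.Quotient.mk ⟨m, hm⟩) = Submodule.Quotient.mk ⟨f m, hf m hm⟩)
    (k : ℕ) (m : M) (hm : m ∈ V χ) :
    ∃ hm' : (f ^ k) m ∈ V χ,
      (F ^ k) (Submodule.Quotient.mk ⟨m, hm⟩) = Submodule.Quotient.mk ⟨(f ^ k) m, hm'⟩ := by
  induction k generalizing m with
  | zero => exact ⟨hm, rfl⟩
  | succ k ih =>
    obtain ⟨h, e⟩ := ih (f m) (hf m hm)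
    simp only [pow_succ, Module.End.mul_apply]
    exact ⟨h, by rw [hF, e]⟩

end Graded

/-- Let `M` be a complex vector space with a rank-`r` Weyl system
`t_1, …, t_r, ∂_1, …, ∂_r`, `θ := Σᵢ tᵢ ∘ ∂ᵢ`, and `(V^χ)_χ` an abstract V-filtration.
Then for every rational `α ≠ 0` the Koszul-type complex `C^α` with `ℓ`-th term
`gr^{α+r-ℓ}(M) ⊗ Λ^ℓ(ℂ^r)` (for `ℓ = 0, …, r`, extended by zero spaces beyond `r`) and
differential induced by `m ⊗ ω ↦ Σᵢ ∂ᵢ(m) ⊗ (eᵢ ∧ ω)` is exact (here `D n i` is the map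
`gr^{α+r-n} → gr^{α+r-(n+1)}` induced by `∂ᵢ` and `δ n` is the Koszul differential;
exactness is expressed as `ker (δ 0) = 0` together with
`ker (δ (n+1)) = range (δ n)` for all `n`). -/
theorem statement3 (r : ℕ) (hr : 1 ≤ r)
    (M : Type*) [AddCommGroup M] [Module ℂ M]
    (t d : Fin r → Module.End ℂ M)
    (htt : ∀ i j, t i * t j = t j * t i)
    (hdd : ∀ i j, d i * d j = d j * d i)
    (hdt : ∀ i j, d i * t j - t j * d i = if i = j then 1 else 0)
    (θ : Module.End ℂ M) (hθ : θ = ∑ i, t i * d i)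
    (V : ℚ → Submodule ℂ M)
    (hmono : ∀ ⦃χ χ' : ℚ⦄, χ ≤ χ' → V χ' ≤ V χ)
    (hVt : ∀ (i : Fin r) (χ : ℚ), ∀ m ∈ V χ, t i m ∈ V (χ + 1))
    (hVd : ∀ (i : Fin r) (χ : ℚ), ∀ m ∈ V χ, d i m ∈ V (χ - 1))
    (hVnil : ∀ (χ : ℚ), ∀ m ∈ V χ, ∃ k : ℕ, 1 ≤ k ∧
      (((θ - ((χ : ℂ) - (r : ℂ)) • 1) ^ k) m ∈ Vgt V χ))
    (α : ℚ) (hα : α ≠ 0)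
    (D : ∀ (n : ℕ), Fin r → (Gr V (α + r - n) →ₗ[ℂ] Gr V (α + r - (n + 1 : ℕ))))
    (hD : ∀ (n : ℕ) (i : Fin r) (m : M) (hm : m ∈ V (α + r - n))
        (hm' : d i m ∈ V (α + r - (n + 1 : ℕ))),
      D n i (Submodule.Quotient.mk ⟨m, hm⟩) = Submodule.Quotient.mk ⟨d i m, hm'⟩)
    (δ : ∀ n : ℕ, (Gr V (α + r - n) ⊗[ℂ] ⋀[ℂ]^n (Fin r → ℂ)) →ₗ[ℂ]
        (Gr V (α + r - (n + 1 : ℕ)) ⊗[ℂ] ⋀[ℂ]^(n+1) (Fin r → ℂ)))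
    (hδ : ∀ (n : ℕ) (x : Gr V (α + r - n)) (ω : ⋀[ℂ]^n (Fin r → ℂ)),
      δ n (x ⊗ₜ[ℂ] ω) = ∑ i, (D n i x) ⊗ₜ[ℂ] (wedgeMap ℂ (Pi.single i 1) n ω)) :
    LinearMap.ker (δ 0) = ⊥ ∧
    ∀ n : ℕ, LinearMap.ker (δ (n+1)) = LinearMap.range (δ n) := by
  have hχ (n : ℕ) : α + r - (n : ℚ) = (α + r - (n + 1 : ℕ)) + 1 := by push_cast; ring
  have hVd' (n : ℕ) (i : Fin r) (m : M) (hm : m ∈ V (α + r - n)) :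
      d i m ∈ V (α + r - (n + 1 : ℕ)) := by
    have h := hVd i _ m hm
    rwa [hχ n, add_sub_cancel_right] at h
  let T (n : ℕ) (i : Fin r) : Gr V (α + r - (n + 1 : ℕ)) →ₗ[ℂ] Gr V (α + r - n) :=
    grMap (t i) (hVt i) (hχ n)
  have hT (n : ℕ) (i : Fin r) (m : M) (hm : m ∈ V (α + r - (n + 1 : ℕ)))
      (hm' : t i m ∈ V (α + r - n)) :
      T n i (Submodule.Quotient.mk ⟨m, hm⟩) = Submodule.Quotient.mk ⟨t i m, hm'⟩ :=
    grMap_mk _ _ _ _ _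
  have hVt' (n : ℕ) (i : Fin r) (m : M) (hm : m ∈ V (α + r - (n + 1 : ℕ))) :
      t i m ∈ V (α + r - n) := by
    rw [hχ n]
    exact hVt i _ m hm
  have hδ' (n : ℕ) : δ n = koszulD (G := fun n : ℕ => Gr V (α + r - n)) D n :=
    TensorProduct.ext' fun x ω => by rw [hδ, koszulD_tmul]
  simp only [hδ']
  refine koszulD_exact (G := fun n : ℕ => Gr V (α + r - n)) D T ?_ ?_
    (a := (α : ℂ)) (by exact_mod_cast hα) ?_
  · intro n i j x
    obtain ⟨⟨m, hm⟩, rfl⟩ := Submodule.Quotient.mk_surjective _ x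
    have h (i : Fin r) := hVd' n i m hm
    rw [hD n j m hm (h j), hD n i m hm (h i), hD (n + 1) i _ _ (hVd' _ _ _ (h j)),
      hD (n + 1) j _ _ (hVd' _ _ _ (h i))]
    congr 2
    exact LinearMap.congr_fun (hdd i j) m
  · intro n i j x
    obtain ⟨⟨m, hm⟩, rfl⟩ := Submodule.Quotient.mk_surjective _ x
    have h1 := hVt' n j m hm
    have h2 := hVd' (n + 1) i m hm
    have e := LinearMap.congr_fun (hdt i j) m
    rw [hT n j m hm h1, hD n i _ h1 (hVd' _ _ _ h1), hD (n + 1) i m hm h2,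
      hT (n + 1) j _ h2 (hVt' _ _ _ h2)]
    rw [LinearMap.sub_apply, Module.End.mul_apply, Module.End.mul_apply, sub_eq_iff_eq_add'] at e
    split_ifs with hij
    · rw [← Submodule.Quotient.mk_add]
      congr 1
      ext
      simpa [hij] using e
    · rw [add_zero]
      congr 1
      ext
      simpa [hij] using e
  · intro n x
    obtain ⟨⟨m, hm⟩, rfl⟩ := Submodule.Quotient.mk_surjective _ x
    obtain ⟨k, -, hk⟩ := hVnil _ m hm
    have hc : (((α + r - n : ℚ) : ℂ) - (r : ℂ)) = (α : ℂ) - n := by push_cast; ring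
    rw [hc] at hk
    have hθV (m : M) (hm : m ∈ V (α + r - n)) : θ m ∈ V (α + r - n) := by
      rw [hθ, LinearMap.sum_apply]
      exact Submodule.sum_mem _ fun i _ => hVt' n i _ (hVd' n i m hm)
    obtain ⟨hm', e⟩ := pow_apply_Gr_mk
      (eulerOp (G := fun n : ℕ => Gr V (α + r - n)) D T n - ((α : ℂ) - (n : ℂ)) • 1)
      (θ - ((α : ℂ) - (n : ℂ)) • 1)
      (fun m hm => sub_mem (hθV m hm) (Submodule.smul_mem _ _ hm))
      (fun m hm => by
        have hE : eulerOp (G := fun n : ℕ => Gr V (α + r - n)) D T n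
            (Submodule.Quotient.mk ⟨m, hm⟩) = Submodule.Quotient.mk ⟨θ m, hθV m hm⟩ := by
          rw [eulerOp, LinearMap.sum_apply]
          have hi (i : Fin r) : (T n i ∘ₗ D n i) (Submodule.Quotient.mk ⟨m, hm⟩) =
              Submodule.mkQ _ ⟨t i (d i m), hVt' n i _ (hVd' n i m hm)⟩ := by
            rw [LinearMap.comp_apply, hD n i m hm (hVd' n i m hm),
              hT n i _ _ (hVt' n i _ (hVd' n i m hm))]
            rfl
          rw [Finset.sum_congr rfl fun i _ => hi i, ← map_sum, Submodule.mkQ_apply]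
          congr 1
          ext
          simp [hθ]
        rw [LinearMap.sub_apply, hE]
        rfl) k m hm
    refine ⟨k, e.trans ?_⟩
    rw [Submodule.Quotient.mk_eq_zero]
    exact hk
end
end

section
/- (Deligne) Let k be a field of characteristic zero and V a finite-dimensional k-vector space. Let L = (L_i)_{i∈ℤ} be a finite increasing filtration of V, let N ∈ End(V) be nilpotent with N(L_i) ⊆ L_i for all i, and let Y ∈ End(V) be semisimple with all eigenvalues integers, satisfying the admissibility conditions Y∘N − N∘Y = −2N and Y(L_i) ⊆ L_i for all i. Set W_m := ⊕_{a≤m} ker(Y − a·id). Assume: (1) W is the relative monodromy filtration of N along L, i.e. for every m ∈ ℤ and every i > 0, N^i induces an isomorphism from ((W_{m+i}∩L_m)+L_{m−1})/((W_{m+i−1}∩L_m)+L_{m−1}) onto ((W_{m−i}∩L_m)+L_{m−1})/((W_{m−i−1}∩L_m)+L_{m−1}); and (2) there exists at least one splitting operator for L commuting with Y. Then there exists a unique splitting operator Y' for L commuting with Y such that (V, L, N, Y, Y') is a Deligne system; that is, a unique semisimple Y' ∈ End(V) with integer eigenvalues such that L_i = ⊕_{j≤i} ker(Y' − j·id) for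 all i, Y∘Y' = Y'∘Y, and, writing N = Σ_{j≤0} N_j for the ad Y'-homogeneous components of N, there exists e⁺ ∈ End(V) with e⁺∘N_0 − N_0∘e⁺ = Y − Y', (Y−Y')∘e⁺ − e⁺∘(Y−Y') = 2e⁺, and e⁺∘N_j = N_j∘e⁺ for all j ≠ 0. -/
noncomputable section

variable {k : Type*} [Field k] {V : Type*} [AddCommGroup V] [Module k V]

/-- `Y₀` is a *splitting operator* for the finite increasing filtration `L`: a semisimple
endomorphism, all of whose eigenvalues are integers (encoded as: the integer eigenspaces
span), with `L i = ⊕_{j ≤ i} ker (Y₀ - j·id)` for every `i`. -/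
def IsSplittingOp (Y₀ : Module.End k V) (L : ℤ → Submodule k V) : Prop :=
  (⨆ j : ℤ, LinearMap.ker (Y₀ - (j : k) • 1)) = ⊤ ∧
  ∀ i : ℤ, L i = ⨆ j : ℤ, ⨆ _ : j ≤ i, LinearMap.ker (Y₀ - (j : k) • 1)

/-- The compatibility condition making `(V, L, N, Y, Y')` a Deligne system: writing
`N = Σ_{j ≤ 0} N_j` for the `ad Y'`-homogeneous components of `N`, there exists `e⁺` with
`[e⁺, N_0] = Y - Y'`, `[Y - Y', e⁺] = 2e⁺` and `[e⁺, N_j] = 0` for all `j ≠ 0`. -/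
def DeligneCompat (Y Y' N : Module.End k V) : Prop :=
  ∃ Nc : ℤ → Module.End k V,
    (Function.support Nc).Finite ∧
    (∀ j : ℤ, 0 < j → Nc j = 0) ∧
    (∑ᶠ j : ℤ, Nc j) = N ∧
    (∀ j : ℤ, Y' * Nc j - Nc j * Y' = (j : k) • Nc j) ∧
    ∃ e : Module.End k V,
      e * Nc 0 - Nc 0 * e = Y - Y' ∧
      (Y - Y') * e - e * (Y - Y') = (2 : k) • e ∧
      ∀ j : ℤ, j ≠ 0 → e * Nc j = Nc j * e

/-- `p` is the family of spectral projections of an endomorphism `T` which is diagonalizable with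
integer eigenvalues contained in the finite set `S`. -/
structure IsSpectralFamily (T : Module.End k V) (S : Finset ℤ) (p : ℤ → Module.End k V) :
    Prop where
  mul_proj : ∀ i, T * p i = (i : k) • p i
  proj_mul : ∀ i, p i * T = (i : k) • p i
  eq_zero : ∀ i ∉ S, p i = 0
  sum_eq_one : ∑ i ∈ S, p i = 1

namespace IsSpectralFamily

theorem exists_of_iSup_ker_eq_top [CharZero k] [FiniteDimensional k V] (T : Module.End k V)
    (hT : (⨆ j : ℤ, LinearMap.ker (T - (j : k) • 1)) = ⊤) :
    ∃ S p, IsSpectralFamily T S p := by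
  have hker : ∀ j : ℤ, LinearMap.ker (T - (j : k) • 1) = T.eigenspace (j : k) := by
    intro j
    ext v
    simp [sub_eq_zero]
  have hfin : {j : ℤ | LinearMap.ker (T - (j : k) • 1) ≠ ⊥}.Finite := by
    simp_rw [hker]
    exact WellFoundedGT.finite_ne_bot_of_iSupIndep
      (T.eigenspaces_iSupIndep.comp (Int.cast_injective (α := k)))
  let S : Finset ℤ := insert 0 hfin.toFinset
  have hinj : Set.InjOn (fun i : ℤ => (i : k)) S := Int.cast_injective.injOn
  let q : ℤ → Polynomial k := fun i => Lagrange.basis S (fun i : ℤ => (i : k)) i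
  let p : ℤ → Module.End k V := fun i => if i ∈ S then Polynomial.aeval T (q i) else 0
  have hmul : ∀ i, T * p i = (i : k) • p i := by
    intro i
    by_cases hi : i ∈ S
    swap
    · simp [p, hi]
    have hle : (⨆ j : ℤ, LinearMap.ker (T - (j : k) • 1)) ≤
        LinearMap.ker (T * p i - (i : k) • p i) := by
      refine iSup_le fun j v hv => ?_
      by_cases hj : j ∈ S
      · have hTv : T v = (j : k) • v := by simpa [sub_eq_zero] using hv
        have hpv : p i v = (q i).eval (j : k) • v := by
          simp only [p, hi, if_true]
          by_cases hv0 : v = 0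
          · simp [hv0]
          · exact Module.End.aeval_apply_of_hasEigenvector
              ⟨Module.End.mem_eigenspace_iff.mpr hTv, hv0⟩
        by_cases hij : i = j
        · subst hij
          simp only [LinearMap.mem_ker, LinearMap.sub_apply, Module.End.mul_apply,
            LinearMap.smul_apply, hpv, map_smul, hTv]
          rw [smul_comm, sub_self]
        · have : (q i).eval (j : k) = 0 :=
            Lagrange.eval_basis_of_ne (v := fun i : ℤ => (i : k)) hij hj
          simp [hpv, this]
      · have : LinearMap.ker (T - (j : k) • 1) = ⊥ := by
          by_contra h
          exact hj (Finset.mem_insert_of_mem (hfin.mem_toFinset.mpr h))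
        rw [this, Submodule.mem_bot] at hv
        simp [hv]
    rw [hT, top_le_iff, LinearMap.ker_eq_top, sub_eq_zero] at hle
    exact hle
  refine ⟨S, p, hmul, fun i => ?_, fun i hi => by simp [p, hi], ?_⟩
  · rw [← hmul i]
    by_cases hi : i ∈ S
    · simp only [p, hi, if_true]
      have := congrArg (Polynomial.aeval T) (mul_comm (q i) Polynomial.X)
      simpa only [map_mul, Polynomial.aeval_X] using this
    · simp [p, hi]
  · have : ∑ i ∈ S, p i = Polynomial.aeval T (∑ i ∈ S, q i) := by
      rw [map_sum]
      exact Finset.sum_congr rfl fun i hi => by simp [p, hi]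
    rw [this, Lagrange.sum_basis hinj ⟨0, by simp [S]⟩, map_one]

variable {T T' : Module.End k V} {S S' : Finset ℤ} {p q : ℤ → Module.End k V}

theorem ext_right (hp : IsSpectralFamily T S p) {X Z : Module.End k V}
    (h : ∀ a, X * p a = Z * p a) : X = Z := by
  rw [← mul_one X, ← mul_one Z, ← hp.sum_eq_one, Finset.mul_sum, Finset.mul_sum]
  exact Finset.sum_congr rfl fun a _ => h a

theorem sum_apply (hp : IsSpectralFamily T S p) (v : V) : ∑ a ∈ S, p a v = v := by
  rw [← LinearMap.sum_apply, hp.sum_eq_one, Module.End.one_apply]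

/-- An intertwiner of degree `d` shifts the spectral projections by `d`. -/
theorem proj_mul_mul_proj_eq_zero [CharZero k] (hp : IsSpectralFamily T S p)
    (hq : IsSpectralFamily T' S' q) {X : Module.End k V} {d : ℤ}
    (hX : T' * X - X * T = (d : k) • X) {a b : ℤ} (hab : b ≠ a + d) : q b * X * p a = 0 := by
  have h : q b * (T' * X - X * T) * p a = ((b : k) - a) • (q b * X * p a) := by
    rw [mul_sub, sub_mul, ← mul_assoc, hq.proj_mul, ← mul_assoc, mul_assoc _ T, hp.mul_proj,
      sub_smul]
    simp
  rw [hX, mul_smul_comm, smul_mul_assoc, ← sub_eq_zero, ← sub_smul, smul_eq_zero] at h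
  refine h.resolve_left fun h0 => hab ?_
  have : ((d - (b - a) : ℤ) : k) = 0 := by push_cast; exact h0
  have := Int.cast_eq_zero.mp this
  omega

theorem proj_mul_eq [CharZero k] (hp : IsSpectralFamily T S p)
    (hq : IsSpectralFamily T' S' q) {X : Module.End k V} {d : ℤ}
    (hX : T' * X - X * T = (d : k) • X) (a : ℤ) : q (a + d) * X = X * p a := by
  have h1 : q (a + d) * X = q (a + d) * X * p a := by
    conv_lhs => rw [← mul_one (q (a + d) * X), ← hp.sum_eq_one, Finset.mul_sum]
    rw [Finset.sum_eq_single a]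
    · intro b _ hb
      exact proj_mul_mul_proj_eq_zero hp hq hX (by omega)
    · intro ha
      rw [hp.eq_zero a ha, mul_zero]
  have h2 : X * p a = q (a + d) * (X * p a) := by
    conv_lhs => rw [← one_mul (X * p a), ← hq.sum_eq_one, Finset.sum_mul]
    rw [Finset.sum_eq_single (a + d)]
    · intro b _ hb
      rw [← mul_assoc]
      exact proj_mul_mul_proj_eq_zero hp hq hX hb
    · intro ha
      rw [hq.eq_zero _ ha, zero_mul]
  rw [h1, h2, mul_assoc]

theorem proj_mul_proj_of_ne [CharZero k] (hp : IsSpectralFamily T S p) {a b : ℤ} (h : a ≠ b) :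
    p a * p b = 0 := by
  have := proj_mul_mul_proj_eq_zero hp hp (X := 1) (d := 0) (by simp) (a := b) (b := a) (by omega)
  simpa using this

theorem proj_mul_self [CharZero k] (hp : IsSpectralFamily T S p) (a : ℤ) : p a * p a = p a := by
  conv_rhs => rw [← mul_one (p a), ← hp.sum_eq_one, Finset.mul_sum]
  rw [Finset.sum_eq_single a]
  · intro b _ hb
    exact hp.proj_mul_proj_of_ne hb.symm
  · intro ha
    rw [hp.eq_zero a ha, mul_zero]

theorem proj_commute [CharZero k] (hp : IsSpectralFamily T S p) {X : Module.End k V}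
    (hX : Commute T X) (a : ℤ) : p a * X = X * p a := by
  simpa using proj_mul_eq hp hp (X := X) (d := 0) (by simp [hX.eq]) a

theorem apply_proj (hp : IsSpectralFamily T S p) (a : ℤ) (v : V) :
    T (p a v) = (a : k) • p a v := by
  simpa using LinearMap.congr_fun (hp.mul_proj a) v

theorem proj_apply_of_ne [CharZero k] (hp : IsSpectralFamily T S p) {a b : ℤ} {v : V}
    (hv : T v = (a : k) • v) (hab : b ≠ a) : p b v = 0 := by
  have h : p b (T v) = (b : k) • p b v := LinearMap.congr_fun (hp.proj_mul b) v
  rw [hv, map_smul, ← sub_eq_zero, ← sub_smul, smul_eq_zero] at h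
  refine h.resolve_left fun h0 => hab ?_
  exact (Int.cast_injective (sub_eq_zero.mp h0)).symm

theorem proj_apply_self [CharZero k] (hp : IsSpectralFamily T S p) {a : ℤ} {v : V}
    (hv : T v = (a : k) • v) : p a v = v := by
  conv_rhs => rw [← hp.sum_apply v]
  rw [Finset.sum_eq_single a]
  · intro b _ hb
    exact hp.proj_apply_of_ne hv hb
  · intro ha
    rw [hp.eq_zero a ha, LinearMap.zero_apply]

theorem iSup_ker_eq_top (hp : IsSpectralFamily T S p) :
    (⨆ j : ℤ, LinearMap.ker (T - (j : k) • 1)) = ⊤ := by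
  refine eq_top_iff.mpr fun v _ => ?_
  rw [← hp.sum_apply v]
  refine Submodule.sum_mem _ fun a _ => Submodule.mem_iSup_of_mem a ?_
  simp [hp.apply_proj]

theorem mem_iSup_le_iff [CharZero k] (hp : IsSpectralFamily T S p) {m : ℤ} {v : V} :
    v ∈ (⨆ a : ℤ, ⨆ _ : a ≤ m, LinearMap.ker (T - (a : k) • 1)) ↔ ∀ b, m < b → p b v = 0 := by
  constructor
  · intro hv b hb
    have : (⨆ a : ℤ, ⨆ _ : a ≤ m, LinearMap.ker (T - (a : k) • 1)) ≤ LinearMap.ker (p b) := by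
      refine iSup_le fun a => iSup_le fun ha w hw => ?_
      exact hp.proj_apply_of_ne (a := a) (by simpa [sub_eq_zero] using hw) (by omega)
    exact this hv
  · intro h
    rw [← hp.sum_apply v]
    refine Submodule.sum_mem _ fun a _ => ?_
    by_cases ha : a ≤ m
    · refine Submodule.mem_iSup_of_mem a (Submodule.mem_iSup_of_mem ha ?_)
      simp [hp.apply_proj]
    · rw [h a (by omega)]
      exact Submodule.zero_mem _

end IsSpectralFamily

/-- The degree `j` part of an endomorphism, for the gradings of source and target
given by two families of projections `p` and `q`. -/
def homComponent (q p : ℤ → Module.End k V) (S : Finset ℤ) (j : ℤ) :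
    Module.End k V →ₗ[k] Module.End k V :=
  ∑ a ∈ S, LinearMap.mulLeft k (q (a + j)) ∘ₗ LinearMap.mulRight k (p a)

theorem homComponent_apply (q p : ℤ → Module.End k V) (S : Finset ℤ) (j : ℤ)
    (X : Module.End k V) : homComponent q p S j X = ∑ a ∈ S, q (a + j) * (X * p a) := by
  simp [homComponent]

section homComponent

variable [CharZero k] {T T' : Module.End k V} {S S' : Finset ℤ} {p q : ℤ → Module.End k V}

theorem homComponent_mul_proj (hp : IsSpectralFamily T S p) (j a : ℤ) (X : Module.End k V) :
    homComponent q p S j X * p a = q (a + j) * X * p a := by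
  rw [homComponent_apply, Finset.sum_mul, Finset.sum_eq_single a]
  · rw [mul_assoc, mul_assoc, hp.proj_mul_self, mul_assoc]
  · intro b _ hb
    rw [mul_assoc, mul_assoc, hp.proj_mul_proj_of_ne hb, mul_zero, mul_zero]
  · intro ha
    rw [hp.eq_zero a ha, mul_zero]

theorem homComponent_degree (hp : IsSpectralFamily T S p) (hq : IsSpectralFamily T' S' q) (j : ℤ)
    (X : Module.End k V) :
    T' * homComponent q p S j X - homComponent q p S j X * T =
      (j : k) • homComponent q p S j X := by
  refine hp.ext_right fun a => ?_
  rw [sub_mul, mul_assoc, mul_assoc _ T, hp.mul_proj, mul_smul_comm, smul_mul_assoc,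
    homComponent_mul_proj hp, ← mul_assoc, ← mul_assoc, hq.mul_proj, smul_mul_assoc,
    smul_mul_assoc, ← sub_smul]
  push_cast
  rw [add_sub_cancel_left]

theorem homComponent_mul_left (hp : IsSpectralFamily T S p) (hq : IsSpectralFamily T' S' q)
    {A : Module.End k V} {d : ℤ} (hA : T' * A - A * T' = (d : k) • A) (j : ℤ)
    (X : Module.End k V) :
    homComponent q p S j (A * X) = A * homComponent q p S (j - d) X := by
  refine hp.ext_right fun a => ?_
  have h := hq.proj_mul_eq hq hA (a + (j - d))
  rw [show a + (j - d) + d = a + j by ring] at h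
  rw [mul_assoc A, homComponent_mul_proj hp, homComponent_mul_proj hp, ← mul_assoc (q _) A X, h]
  simp only [mul_assoc]

theorem homComponent_mul_right (hp : IsSpectralFamily T S p)
    {A : Module.End k V} {d : ℤ} (hA : T * A - A * T = (d : k) • A) (j : ℤ)
    (X : Module.End k V) :
    homComponent q p S j (X * A) = homComponent q p S (j - d) X * A := by
  refine hp.ext_right fun a => ?_
  have h := hp.proj_mul_eq hp hA a
  rw [homComponent_mul_proj hp, mul_assoc _ A, ← h, ← mul_assoc (homComponent q p S _ X),
    homComponent_mul_proj hp, show a + d + (j - d) = a + j by ring, mul_assoc _ _ A, h]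
  simp only [mul_assoc]

theorem exists_homComponent_eq_zero (hp : IsSpectralFamily T S p)
    (hq : IsSpectralFamily T' S' q) :
    ∃ B : ℕ, ∀ j : ℤ, (B : ℤ) < |j| → ∀ X, homComponent q p S j X = 0 := by
  obtain ⟨B, hB⟩ : ∃ B : ℕ, ∀ b ∈ S', ∀ a ∈ S, |b - a| ≤ B := by
    refine ⟨∑ b ∈ S', ∑ a ∈ S, (b - a).natAbs, fun b hb a ha => ?_⟩
    rw [Int.abs_eq_natAbs, Int.ofNat_le]
    exact (Finset.single_le_sum (f := fun a => (b - a).natAbs) (fun _ _ => Nat.zero_le _) ha).trans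
      (Finset.single_le_sum (f := fun b => ∑ a ∈ S, (b - a).natAbs) (fun _ _ => Nat.zero_le _) hb)
  refine ⟨B, fun j hj X => hp.ext_right fun a => ?_⟩
  rw [homComponent_mul_proj hp, zero_mul]
  by_cases ha : a ∈ S
  · rw [hq.eq_zero (a + j), zero_mul, zero_mul]
    intro hb
    have := hB _ hb _ ha
    rw [add_sub_cancel_left] at this
    omega
  · rw [hp.eq_zero a ha, mul_zero]

theorem finite_support_homComponent (hp : IsSpectralFamily T S p)
    (hq : IsSpectralFamily T' S' q) (X : Module.End k V) :
    (Function.support fun j => homComponent q p S j X).Finite := by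
  obtain ⟨B, hB⟩ := exists_homComponent_eq_zero hp hq
  refine (Set.finite_Icc (-(B : ℤ)) B).subset fun j hj => ?_
  rw [Set.mem_Icc, ← abs_le]
  by_contra h
  exact hj (hB j (not_le.mp h) X)

theorem finsum_homComponent (hp : IsSpectralFamily T S p)
    (hq : IsSpectralFamily T' S' q) (X : Module.End k V) :
    ∑ᶠ j, homComponent q p S j X = X := by
  refine hp.ext_right fun a => ?_
  rw [finsum_mul' _ _ (finite_support_homComponent hp hq X)]
  simp_rw [homComponent_mul_proj hp]
  have h : ∑ᶠ b, q b * (X * p a) = X * p a := by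
    rw [finsum_eq_sum_of_support_subset (s := S'), ← Finset.sum_mul, hq.sum_eq_one, one_mul]
    intro b hb
    by_contra hbS
    exact hb (by simp [hq.eq_zero b hbS])
  refine Eq.trans ?_ ((finsum_comp_equiv (Equiv.addLeft a) (f := fun b => q b * (X * p a))).trans h)
  simp [mul_assoc]

theorem homComponent_of_degree (hp : IsSpectralFamily T S p) (hq : IsSpectralFamily T' S' q)
    {X : Module.End k V} {d : ℤ} (hX : T' * X - X * T = (d : k) • X) (j : ℤ) :
    homComponent q p S j X = if j = d then X else 0 := by
  refine hp.ext_right fun a => ?_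
  rw [homComponent_mul_proj hp]
  split_ifs with h
  · rw [h, hp.proj_mul_eq hq hX, mul_assoc, hp.proj_mul_self]
  · rw [hp.proj_mul_mul_proj_eq_zero hq hX (by omega), zero_mul]

end homComponent

/-- In a finite-dimensional representation of `sl₂`, the operator `e ∘ f` is injective on
the vectors of positive weight. -/
theorem eq_zero_of_sl2_raise_lower_eq_zero {M : Type*} [AddCommGroup M] [Module k M] [CharZero k]
    [FiniteDimensional k M] {e f h : Module.End k M} (hef : e * f - f * e = h)
    (hhe : h * e - e * h = (2 : k) • e) {w : ℕ} (hw : 0 < w) {x : M} (hx : h x = (w : k) • x)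
    (hefx : e (f x) = 0) : x = 0 := by
  have hef' : ∀ y, e (f y) = f (e y) + h y := fun y => by
    rw [← hef]; simp
  have hhe' : ∀ y, h (e y) = e (h y) + (2 : k) • e y := fun y => by
    have := LinearMap.congr_fun hhe y
    simp only [LinearMap.sub_apply, Module.End.mul_apply, LinearMap.smul_apply] at this
    rw [← this]; abel
  have hweight : ∀ i : ℕ, h ((e ^ i) x) = ((w + 2 * i : ℕ) : k) • (e ^ i) x := by
    intro i
    induction i with
    | zero => simpa using hx
    | succ i ih =>
      rw [pow_succ', Module.End.mul_apply, hhe', ih, map_smul, ← add_smul]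
      push_cast
      ring_nf
  have hsucc : ∀ i : ℕ, e ((e ^ i) x) = (e ^ (i + 1)) x := fun i => by
    rw [pow_succ', Module.End.mul_apply]
  have hlower : ∀ i : ℕ, ∃ c : ℕ, 0 < c ∧ f ((e ^ (i + 1)) x) = -(c : k) • (e ^ i) x := by
    intro i
    induction i with
    | zero =>
      refine ⟨w, hw, ?_⟩
      have := hef' x
      rw [hefx, hx] at this
      simp [eq_neg_of_add_eq_zero_left this.symm]
    | succ i ih =>
      obtain ⟨c, hc, hcx⟩ := ih
      refine ⟨c + (w + 2 * (i + 1)), by omega, ?_⟩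
      have := hef' ((e ^ (i + 1)) x)
      rw [hcx, hweight, map_smul, hsucc, hsucc, ← sub_eq_iff_eq_add] at this
      rw [← this, ← sub_smul]
      push_cast
      ring_nf
  by_contra hx0
  have hne : ∀ i : ℕ, (e ^ i) x ≠ 0 := by
    intro i
    induction i with
    | zero => simpa using hx0
    | succ i ih =>
      intro h0
      obtain ⟨c, hc, hcx⟩ := hlower i
      rw [h0, map_zero, eq_comm, smul_eq_zero, neg_eq_zero, Nat.cast_eq_zero] at hcx
      exact hcx.elim (by omega) ih
  have hinj : Function.Injective fun i : ℕ => ((w + 2 * i : ℕ) : k) :=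
    Nat.cast_injective.comp fun i j hij => by simpa using hij
  have hli := h.eigenvectors_linearIndependent' _ hinj (fun i => (e ^ i) x)
    fun i => ⟨Module.End.mem_eigenspace_iff.mpr (hweight i), hne i⟩
  exact not_finite_iff_infinite.mpr inferInstance hli.finite

/-- A linear map `X` of positive weight between two finite-dimensional representations of `sl₂`
vanishes if lowering and then raising it gives zero. -/
theorem intertwiner_eq_zero [CharZero k] [FiniteDimensional k V]
    {e f h e' f' h' : Module.End k V} (hef : e * f - f * e = h) (hhe : h * e - e * h = (2 : k) • e)
    (hef' : e' * f' - f' * e' = h') (hhe' : h' * e' - e' * h' = (2 : k) • e')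
    {w : ℕ} (hw : 0 < w) {X : Module.End k V} (hX : h * X - X * h' = (w : k) • X)
    (hefX : e * (f * X - X * f') - (f * X - X * f') * e' = 0) : X = 0 := by
  refine eq_zero_of_sl2_raise_lower_eq_zero
    (e := LinearMap.mulLeft k e - LinearMap.mulRight k e')
    (f := LinearMap.mulLeft k f - LinearMap.mulRight k f')
    (h := LinearMap.mulLeft k h - LinearMap.mulRight k h') ?_ ?_ hw (by simpa using hX)
    (by simpa using hefX)
  · refine LinearMap.ext fun Z => ?_
    simp only [LinearMap.sub_apply, Module.End.mul_apply, LinearMap.mulLeft_apply,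
      LinearMap.mulRight_apply, ← hef, ← hef']
    noncomm_ring
  · refine LinearMap.ext fun Z => ?_
    have h1 : (2 : k) • (e * Z - Z * e') = ((2 : k) • e) * Z - Z * ((2 : k) • e') := by
      simp [smul_sub]
    simp only [LinearMap.sub_apply, Module.End.mul_apply, LinearMap.mulLeft_apply,
      LinearMap.mulRight_apply, LinearMap.smul_apply]
    rw [h1, ← hhe, ← hhe']
    noncomm_ring

theorem trace_mul_eq_zero_of_forall [FiniteDimensional k V] {Z : Module.End k V}
    (h : ∀ X : Module.End k V, LinearMap.trace k V (X * Z) = 0) : Z = 0 := by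
  refine LinearMap.ext fun v => ?_
  rw [LinearMap.zero_apply, ← Module.forall_dual_apply_eq_zero_iff k]
  intro φ
  have := h (φ.smulRight v)
  rw [LinearMap.trace_mul_comm] at this
  have h2 : Z * φ.smulRight v = φ.smulRight (Z v) := by
    ext; simp
  rw [h2, LinearMap.trace_smulRight] at this
  exact this

/-- An endomorphism lies in the image of `ad f` as soon as it is orthogonal to the centralizer of
`f` for the trace form. -/
theorem exists_commutator_eq_of_trace [FiniteDimensional k V] {f H : Module.End k V}
    (hH : ∀ Z, Z * f = f * Z → LinearMap.trace k V (H * Z) = 0) :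
    ∃ X, X * f - f * X = H := by
  let A : Module.End k (Module.End k V) := LinearMap.mulRight k f - LinearMap.mulLeft k f
  let τ : Module.End k V →ₗ[k] Module.Dual k (Module.End k V) :=
    (LinearMap.mul k (Module.End k V)).flip.compr₂ (LinearMap.trace k V)
  have hτ : ∀ Z X, τ Z X = LinearMap.trace k V (X * Z) := fun Z X => rfl
  have hinj : Function.Injective τ := by
    rw [← LinearMap.ker_eq_bot, LinearMap.ker_eq_bot']
    exact fun Z hZ => trace_mul_eq_zero_of_forall fun X => by rw [← hτ, hZ, LinearMap.zero_apply]
  have hsurj : Function.Surjective τ :=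
    (LinearMap.injective_iff_surjective_of_finrank_eq_finrank
      Subspace.dual_finrank_eq.symm).mp hinj
  suffices H ∈ LinearMap.range A by
    obtain ⟨X, hX⟩ := this
    exact ⟨X, hX⟩
  by_contra hmem
  obtain ⟨φ, hφH, hφ⟩ := Submodule.exists_dual_map_eq_bot_of_notMem hmem inferInstance
  obtain ⟨Z, rfl⟩ := hsurj φ
  refine hφH (hH Z ?_)
  rw [eq_comm, ← sub_eq_zero]
  refine trace_mul_eq_zero_of_forall fun X => ?_
  have h0 : τ Z (A X) = 0 := by
    have : τ Z (A X) ∈ (LinearMap.range A).map (τ Z) := ⟨A X, ⟨X, rfl⟩, rfl⟩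
    rwa [hφ, Submodule.mem_bot] at this
  have hA : A X = X * f - f * X := rfl
  rw [hτ, hA, sub_mul, map_sub, mul_assoc f, LinearMap.trace_mul_comm k f] at h0
  rw [mul_sub, map_sub, ← mul_assoc, ← mul_assoc]
  exact h0

theorem IsSpectralFamily.proj_mul_pow [CharZero k] {H f : Module.End k V} {R : Finset ℤ}
    {r : ℤ → Module.End k V} (hr : IsSpectralFamily H R r)
    (hHf : H * f - f * H = (-2 : k) • f) (n : ℕ) (a : ℤ) :
    r (a - 2 * n) * f ^ n = f ^ n * r a := by
  induction n generalizing a with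
  | zero => simp
  | succ n ih =>
    have := hr.proj_mul_eq hr (d := -2) (by simpa using hHf) (a - 2 * n)
    rw [pow_succ', ← mul_assoc, show a - 2 * ((n + 1 : ℕ) : ℤ) = a - 2 * n + -2 by
      push_cast; ring, this, mul_assoc, ih, mul_assoc]

/-- An endomorphism commuting with the lowering operator `f` has equal traces on the opposite weight
spaces identified by a power of `f`. -/
theorem trace_proj_mul_eq [CharZero k] {H f Z : Module.End k V}
    {R : Finset ℤ} {r : ℤ → Module.End k V} (hr : IsSpectralFamily H R r)
    (hHf : H * f - f * H = (-2 : k) • f) (hZ : Z * f = f * Z) {i : ℕ}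
    (hinj : ∀ x, H x = (i : k) • x → (f ^ i) x = 0 → x = 0)
    (hsurj : ∀ y, H y = -(i : k) • y → ∃ x, H x = (i : k) • x ∧ (f ^ i) x = y) :
    LinearMap.trace k V (r i * Z) = LinearMap.trace k V (r (-i) * Z) := by
  have hfri : r (-i) * f ^ i = f ^ i * r i := by
    rw [← hr.proj_mul_pow hHf i i]
    congr 2
    ring
  obtain ⟨s, hs⟩ := (f ^ i * r i).rangeRestrict.exists_rightInverse_of_surjective
    (LinearMap.range_rangeRestrict _)
  have hmem : ∀ v, r (-i) v ∈ LinearMap.range (f ^ i * r i) := by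
    intro v
    obtain ⟨x, hx, hxv⟩ := hsurj (r (-i) v) (by simpa using hr.apply_proj (-i) v)
    refine ⟨x, ?_⟩
    rw [Module.End.mul_apply, hr.proj_apply_self (by simpa using hx), hxv]
  let g : Module.End k V := r i * (s ∘ₗ (r (-i)).codRestrict _ hmem)
  have hfg : f ^ i * g = r (-i) := by
    refine LinearMap.ext fun v => ?_
    exact congrArg Subtype.val (LinearMap.congr_fun hs ⟨r (-i) v, hmem v⟩)
  have hgf : g * (f ^ i * r i) = r i := by
    refine LinearMap.ext fun v => ?_
    rw [← sub_eq_zero, ← LinearMap.sub_apply]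
    have h1 : r i * (g * (f ^ i * r i) - r i) = g * (f ^ i * r i) - r i := by
      rw [mul_sub, hr.proj_mul_self, ← mul_assoc]
      simp only [g, ← mul_assoc, hr.proj_mul_self]
    refine hinj _ ?_ ?_
    · rw [← h1]
      simpa using hr.apply_proj i ((g * (f ^ i * r i) - r i) v)
    · rw [← Module.End.mul_apply, mul_sub, ← mul_assoc, hfg, ← mul_assoc, hfri, mul_assoc,
        hr.proj_mul_self, sub_self, LinearMap.zero_apply]
  have hZi : Z * f ^ i = f ^ i * Z := (Commute.pow_right (show Commute Z f from hZ) i).eq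
  calc LinearMap.trace k V (r i * Z)
      = LinearMap.trace k V (g * r (-i) * Z * f ^ i) := by
        rw [mul_assoc (g * _), hZi, ← mul_assoc, mul_assoc g, hfri, hgf]
    _ = LinearMap.trace k V (f ^ i * (g * r (-i) * Z)) := LinearMap.trace_mul_comm _ _ _
    _ = LinearMap.trace k V (r (-i) * Z) := by
        rw [← mul_assoc, ← mul_assoc, hfg, hr.proj_mul_self]

/-- An operator of weight `-2` with the hard Lefschetz property is the lowering operator of an
`sl₂`-triple, which can be chosen to commute with a given diagonalizable operator `Y₀`. -/
theorem exists_raising_operator [CharZero k] [FiniteDimensional k V] {H Y₀ f : Module.End k V}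
    {R S : Finset ℤ} {r p : ℤ → Module.End k V} (hr : IsSpectralFamily H R r)
    (hp : IsSpectralFamily Y₀ S p) (hHY : Commute Y₀ H)
    (hHf : H * f - f * H = (-2 : k) • f) (hYf : Commute Y₀ f)
    (hinj : ∀ i : ℕ, 0 < i → ∀ x, H x = (i : k) • x → (f ^ i) x = 0 → x = 0)
    (hsurj : ∀ i : ℕ, 0 < i → ∀ y, H y = -(i : k) • y → ∃ x, H x = (i : k) • x ∧ (f ^ i) x = y) :
    ∃ e, e * f - f * e = H ∧ H * e - e * H = (2 : k) • e ∧ Commute Y₀ e := by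
  have htrace : ∀ Z, Z * f = f * Z → LinearMap.trace k V (H * Z) = 0 := by
    intro Z hZ
    set t : ℤ → k := fun i => LinearMap.trace k V (r i * Z) with ht
    have hnat : ∀ i : ℕ, t i = t (-i) := by
      intro i
      rcases Nat.eq_zero_or_pos i with rfl | hi
      · simp
      · exact trace_proj_mul_eq hr hHf hZ (hinj i hi) (hsurj i hi)
    have hneg : ∀ i : ℤ, t (-i) = t i := by
      intro i
      obtain ⟨n, rfl | rfl⟩ := i.eq_nat_or_neg
      · exact (hnat n).symm
      · rw [neg_neg]; exact hnat n
    have hsum : LinearMap.trace k V (H * Z) = ∑ᶠ i : ℤ, (i : k) * t i := by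
      rw [finsum_eq_sum_of_support_subset (s := R)]
      · conv_lhs => rw [← mul_one H, ← hr.sum_eq_one, Finset.mul_sum, Finset.sum_mul, map_sum]
        refine Finset.sum_congr rfl fun i _ => ?_
        rw [hr.mul_proj, smul_mul_assoc, map_smul, smul_eq_mul]
      · intro i hi
        by_contra hiR
        exact hi (by simp [ht, hr.eq_zero i hiR])
    rw [hsum, ← self_eq_neg, ← finsum_neg_distrib]
    conv_lhs => rw [← finsum_comp_equiv (Equiv.neg ℤ)]
    exact finsum_congr fun i => by simp [hneg]
  obtain ⟨X, hX⟩ := exists_commutator_eq_of_trace htrace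
  let X₂ := homComponent r r R 2 X
  have hX₂ : X₂ * f - f * X₂ = H := by
    have h := congrArg (homComponent r r R 0) hX
    have hHf' : H * f - f * H = ((-2 : ℤ) : k) • f := by simpa using hHf
    rw [map_sub, homComponent_mul_right hr hHf', homComponent_mul_left hr hr hHf',
      homComponent_of_degree hr hr (d := 0) (X := H) (by simp)] at h
    simpa using h
  have hHX₂ : H * X₂ - X₂ * H = (2 : k) • X₂ := by
    simpa using homComponent_degree hr hr 2 X
  have hYf' : Y₀ * f - f * Y₀ = ((0 : ℤ) : k) • f := by simp [hYf.eq]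
  have hYH' : Y₀ * H - H * Y₀ = ((0 : ℤ) : k) • H := by simp [hHY.eq]
  refine ⟨homComponent p p S 0 X₂, ?_, ?_, ?_⟩
  · have h := congrArg (homComponent p p S 0) hX₂
    rw [map_sub, homComponent_mul_right hp hYf', homComponent_mul_left hp hp hYf',
      homComponent_of_degree hp hp hYH'] at h
    simpa using h
  · have h := congrArg (homComponent p p S 0) hHX₂
    rw [map_sub, homComponent_mul_right hp hYH', homComponent_mul_left hp hp hYH', map_smul] at h
    simpa using h
  · have h := homComponent_degree hp hp 0 X₂
    rw [Int.cast_zero, zero_smul, sub_eq_zero] at h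
    exact h

/-- On vectors of degree at most `m`, an endomorphism without components of positive degree acts on
the degree `m` part through its component of degree zero. -/
theorem proj_pow_apply [CharZero k] {Y₀ N : Module.End k V} {S : Finset ℤ}
    {p : ℤ → Module.End k V} (hp : IsSpectralFamily Y₀ S p)
    (hN : ∀ j, 0 < j → homComponent p p S j N = 0) {m : ℤ} {x : V}
    (hx : ∀ b, m < b → p b x = 0) (i : ℕ) :
    (∀ b, m < b → p b ((N ^ i) x) = 0) ∧
      p m ((N ^ i) x) = ((homComponent p p S 0 N) ^ i) (p m x) := by
  have key : ∀ b v, p b (N v) = ∑ a ∈ S, homComponent p p S (b - a) N (p a v) := by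
    intro b v
    conv_lhs => rw [← hp.sum_apply v, map_sum, map_sum]
    refine Finset.sum_congr rfl fun a _ => ?_
    have := LinearMap.congr_fun (homComponent_mul_proj (q := p) hp (b - a) a N) v
    rw [add_sub_cancel] at this
    exact this.symm
  induction i with
  | zero => exact ⟨by simpa using hx, by simp⟩
  | succ i ih =>
    rw [pow_succ', pow_succ', Module.End.mul_apply, Module.End.mul_apply, ← ih.2]
    constructor
    · intro b hb
      rw [key]
      refine Finset.sum_eq_zero fun a _ => ?_
      rcases le_or_gt a m with ha | ha
      · rw [hN _ (by omega), LinearMap.zero_apply]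
      · rw [ih.1 a ha, map_zero]
    · rw [key, Finset.sum_eq_single m]
      · rw [sub_self]
      · intro a _ ha
        rcases lt_or_gt_of_ne ha with ha | ha
        · rw [hN _ (by omega), LinearMap.zero_apply]
        · rw [ih.1 a ha, map_zero]
      · intro hm
        rw [hp.eq_zero m hm, LinearMap.zero_apply, map_zero]

section Lefschetz

variable [CharZero k] {Y Y₀ N : Module.End k V} {Sy S : Finset ℤ} {y p : ℤ → Module.End k V}
  {L W : ℤ → Submodule k V}

theorem proj_proj_eq_zero_of_mem_sup (hy : IsSpectralFamily Y Sy y) (hYY₀ : Commute Y Y₀)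
    (hp : IsSpectralFamily Y₀ S p) (hL : ∀ i v, v ∈ L i ↔ ∀ b, i < b → p b v = 0)
    (hW : ∀ i v, v ∈ W i ↔ ∀ b, i < b → y b v = 0) {c m : ℤ} {v : V}
    (hv : v ∈ (W c ⊓ L m) ⊔ L (m - 1)) {b : ℤ} (hb : c < b) : y b (p m v) = 0 := by
  obtain ⟨w, hw, l, hl, rfl⟩ := Submodule.mem_sup.mp hv
  have hyp : y b * p m = p m * y b := hy.proj_commute (hp.proj_commute hYY₀.symm m).symm b
  rw [map_add, (hL _ l).mp hl m (by omega), add_zero, ← Module.End.mul_apply, hyp,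
    Module.End.mul_apply, (hW _ w).mp hw.1 b hb, map_zero]

theorem homComponent_lower (hp : IsSpectralFamily Y₀ S p) (hYY₀ : Commute Y Y₀)
    (hYN : Y * N - N * Y = (-2 : k) • N) (j : ℤ) :
    Y * homComponent p p S j N - homComponent p p S j N * Y =
      (-2 : k) • homComponent p p S j N := by
  have hY : Y₀ * Y - Y * Y₀ = ((0 : ℤ) : k) • Y := by simp [hYY₀.eq]
  have h := congrArg (homComponent p p S j) hYN
  rw [map_sub, homComponent_mul_right hp hY, homComponent_mul_left hp hp hY, map_smul] at h
  simpa using h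

theorem eq_zero_of_pow_homComponent_eq_zero (hy : IsSpectralFamily Y Sy y) (hYY₀ : Commute Y Y₀)
    (hp : IsSpectralFamily Y₀ S p) (hL : ∀ i v, v ∈ L i ↔ ∀ b, i < b → p b v = 0)
    (hW : ∀ i v, v ∈ W i ↔ ∀ b, i < b → y b v = 0)
    (hN : ∀ j, 0 < j → homComponent p p S j N = 0) {i : ℕ}
    (hinj : ∀ m : ℤ, ∀ x ∈ (W (m + i) ⊓ L m) ⊔ L (m - 1),
      (N ^ i) x ∈ (W (m - i - 1) ⊓ L m) ⊔ L (m - 1) →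
        x ∈ (W (m + i - 1) ⊓ L m) ⊔ L (m - 1))
    {x : V} (hx : (Y - Y₀) x = (i : k) • x) (hfx : (homComponent p p S 0 N ^ i) x = 0) : x = 0 := by
  rw [← hp.sum_apply x]
  refine Finset.sum_eq_zero fun m _ => ?_
  have hf : Commute Y₀ (homComponent p p S 0 N) := by
    have := homComponent_degree hp hp 0 N
    rwa [Int.cast_zero, zero_smul, sub_eq_zero] at this
  have hfm : (homComponent p p S 0 N ^ i) (p m x) = 0 := by
    rw [← Module.End.mul_apply, ← hp.proj_commute (hf.pow_right i), Module.End.mul_apply, hfx,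
      map_zero]
  have hYx : Y (p m x) = ((m + i : ℤ) : k) • p m x := by
    have h1 : Y x = Y₀ x + (i : k) • x := by rw [← hx]; simp
    rw [← Module.End.mul_apply, ← hp.proj_commute hYY₀.symm, Module.End.mul_apply, h1, map_add,
      ← Module.End.mul_apply, hp.proj_mul, map_smul, LinearMap.smul_apply, ← add_smul]
    push_cast
    rfl
  have hpm : ∀ b, b ≠ m → p b (p m x) = 0 := fun b hb =>
    hp.proj_apply_of_ne (hp.apply_proj m x) hb
  have hmL : p m x ∈ L m := (hL _ _).mpr fun b hb => hpm b (by omega)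
  have hmem : p m x ∈ (W (m + i - 1) ⊓ L m) ⊔ L (m - 1) := by
    refine hinj m _ (Submodule.mem_sup_left ⟨?_, hmL⟩) (Submodule.mem_sup_right ?_)
    · exact (hW _ _).mpr fun b hb => hy.proj_apply_of_ne hYx (by omega)
    · have h := proj_pow_apply hp hN ((hL _ _).mp hmL) i
      refine (hL _ _).mpr fun b hb => ?_
      rcases (show m ≤ b by omega).eq_or_lt with rfl | hb
      · rw [h.2, hp.proj_apply_self (hp.apply_proj _ x), hfm]
      · exact h.1 b hb
  have h0 := proj_proj_eq_zero_of_mem_sup hy hYY₀ hp hL hW hmem (b := m + i) (by omega)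
  rwa [hp.proj_apply_self (hp.apply_proj _ x), hy.proj_apply_self hYx] at h0

theorem exists_pow_homComponent_eq (hy : IsSpectralFamily Y Sy y) (hYY₀ : Commute Y Y₀)
    (hp : IsSpectralFamily Y₀ S p) (hL : ∀ i v, v ∈ L i ↔ ∀ b, i < b → p b v = 0)
    (hW : ∀ i v, v ∈ W i ↔ ∀ b, i < b → y b v = 0)
    (hYN : Y * N - N * Y = (-2 : k) • N)
    (hN : ∀ j, 0 < j → homComponent p p S j N = 0) {i : ℕ}
    (hsurj : ∀ m : ℤ, ∀ z ∈ (W (m - i) ⊓ L m) ⊔ L (m - 1), ∃ x ∈ (W (m + i) ⊓ L m) ⊔ L (m - 1),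
      (N ^ i) x - z ∈ (W (m - i - 1) ⊓ L m) ⊔ L (m - 1))
    {z : V} (hz : (Y - Y₀) z = -(i : k) • z) :
    ∃ x, (Y - Y₀) x = (i : k) • x ∧ (homComponent p p S 0 N ^ i) x = z := by
  set f := homComponent p p S 0 N
  have hYf : Y * f - f * Y = (-2 : k) • f := homComponent_lower hp hYY₀ hYN 0
  have hgr : ∀ m : ℤ, ∃ x, (Y - Y₀) x = (i : k) • x ∧ (f ^ i) x = p m z := by
    intro m
    have hYz : Y (p m z) = ((m - i : ℤ) : k) • p m z := by
      have h1 : Y z = Y₀ z - (i : k) • z := by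
        rw [sub_eq_add_neg, ← neg_smul, ← hz]; simp
      rw [← Module.End.mul_apply, ← hp.proj_commute hYY₀.symm, Module.End.mul_apply, h1, map_sub,
        ← Module.End.mul_apply, hp.proj_mul, map_smul, LinearMap.smul_apply, ← sub_smul]
      push_cast
      rfl
    obtain ⟨x, hx, hxz⟩ := hsurj m (p m z) <| Submodule.mem_sup_left
      ⟨(hW _ _).mpr fun b hb => hy.proj_apply_of_ne hYz (by omega),
        (hL _ _).mpr fun b hb => hp.proj_apply_of_ne (hp.apply_proj m z) (by omega)⟩
    have hxL : ∀ b, m < b → p b x = 0 := by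
      obtain ⟨w, hw, l, hl, rfl⟩ := Submodule.mem_sup.mp hx
      intro b hb
      rw [map_add, (hL _ w).mp hw.2 b hb, (hL _ l).mp hl b (by omega), add_zero]
    have hcomm : p m * y (m + i) = y (m + i) * p m :=
      hp.proj_commute (hy.proj_commute hYY₀ _).symm m
    refine ⟨y (m + i) (p m x), ?_, ?_⟩
    · rw [LinearMap.sub_apply, hy.apply_proj, ← Module.End.mul_apply (y _), ← hcomm,
        Module.End.mul_apply, hp.apply_proj, ← sub_smul]
      push_cast
      rw [add_sub_cancel_left]
    · have h1 := LinearMap.congr_fun (hy.proj_mul_pow hYf i (m + i)) (p m x)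
      rw [show m + i - 2 * (i : ℤ) = m - i by ring] at h1
      rw [← Module.End.mul_apply, ← h1, Module.End.mul_apply, ← (proj_pow_apply hp hN hxL i).2]
      have h2 := proj_proj_eq_zero_of_mem_sup hy hYY₀ hp hL hW hxz (b := m - i) (by omega)
      rwa [map_sub, map_sub, hp.proj_apply_self (hp.apply_proj m z), hy.proj_apply_self hYz,
        sub_eq_zero] at h2
  choose x hx hfx using hgr
  refine ⟨∑ m ∈ S, x m, ?_, ?_⟩
  · rw [map_sum, Finset.smul_sum]
    exact Finset.sum_congr rfl fun m _ => hx m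
  · rw [map_sum]
    exact (Finset.sum_congr rfl fun m _ => hfx m).trans (hp.sum_apply z)

end Lefschetz

section Uniqueness

variable [CharZero k] {Y T T' N : Module.End k V} {S S' : Finset ℤ} {p q : ℤ → Module.End k V}

/-- The Deligne compatibility condition in terms of the homogeneous components of `N`. -/
theorem deligneCompat_iff (hp : IsSpectralFamily T S p) :
    DeligneCompat Y T N ↔ (∀ j, 0 < j → homComponent p p S j N = 0) ∧
      ∃ e : Module.End k V, e * homComponent p p S 0 N - homComponent p p S 0 N * e = Y - T ∧
        (Y - T) * e - e * (Y - T) = (2 : k) • e ∧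
        ∀ j, j ≠ 0 → e * homComponent p p S j N = homComponent p p S j N * e := by
  constructor
  · rintro ⟨Nc, hfin, hpos, rfl, hdeg, he⟩
    have hNc : ∀ j, homComponent p p S j (∑ᶠ i, Nc i) = Nc j := by
      intro j
      rw [← LinearMap.toAddMonoidHom_coe, AddMonoidHom.map_finsum _ hfin, finsum_eq_single _ j]
      · simp [homComponent_of_degree hp hp (hdeg j)]
      · intro i hi
        simp [homComponent_of_degree hp hp (hdeg i), hi.symm]
    simp only [hNc]
    exact ⟨hpos, he⟩
  · rintro ⟨hpos, he⟩
    exact ⟨fun j => homComponent p p S j N, finite_support_homComponent hp hp N, hpos,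
      finsum_homComponent hp hp N, fun j => homComponent_degree hp hp j N, he⟩

theorem homComponent_mul_eq_finsum (hp : IsSpectralFamily T S p) (hq : IsSpectralFamily T' S' q)
    (A X : Module.End k V) (j : ℤ) :
    homComponent q p S j (A * X) =
      ∑ᶠ i, homComponent q q S' i A * homComponent q p S (j - i) X := by
  have hfin := finite_support_homComponent hq hq A
  conv_lhs => rw [← finsum_homComponent hq hq A, finsum_mul' _ _ hfin]
  rw [← LinearMap.toAddMonoidHom_coe, AddMonoidHom.map_finsum]
  · exact finsum_congr fun i => homComponent_mul_left hp hq (homComponent_degree hq hq i A) j X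
  · exact hfin.subset fun i hi h => hi (by simp [h])

theorem homComponent_mul_eq_finsum' (hp : IsSpectralFamily T S p) (X A : Module.End k V)
    (j : ℤ) :
    homComponent q p S j (X * A) =
      ∑ᶠ i, homComponent q p S (j - i) X * homComponent p p S i A := by
  have hfin := finite_support_homComponent hp hp A
  conv_lhs => rw [← finsum_homComponent hp hp A, mul_finsum' _ _ hfin]
  rw [← LinearMap.toAddMonoidHom_coe, AddMonoidHom.map_finsum]
  · exact finsum_congr fun i => homComponent_mul_right hp (homComponent_degree hp hp i A) j X
  · exact hfin.subset fun i hi h => hi (by simp [h])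

theorem deligne_splitting_unique [FiniteDimensional k V] {L : ℤ → Submodule k V}
    (hp : IsSpectralFamily T S p) (hq : IsSpectralFamily T' S' q)
    (hLp : ∀ i v, v ∈ L i ↔ ∀ b, i < b → p b v = 0)
    (hLq : ∀ i v, v ∈ L i ↔ ∀ b, i < b → q b v = 0)
    (hYT : Commute Y T) (hYT' : Commute Y T')
    (hT : DeligneCompat Y T N) (hT' : DeligneCompat Y T' N) : T' = T := by
  obtain ⟨hpos, e, hef, hhe, hcomm⟩ := (deligneCompat_iff hp).mp hT
  obtain ⟨hpos', e', hef', hhe', hcomm'⟩ := (deligneCompat_iff hq).mp hT'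
  set X : ℤ → Module.End k V := fun j => homComponent q p S j 1
  set M : ℤ → Module.End k V := fun j => homComponent p p S j N
  set M' : ℤ → Module.End k V := fun j => homComponent q q S' j N
  change e * M 0 - M 0 * e = Y - T at hef
  change e' * M' 0 - M' 0 * e' = Y - T' at hef'
  have hXpos : ∀ j, 0 < j → X j = 0 := by
    intro j hj
    refine hp.ext_right fun a => LinearMap.ext fun v => ?_
    rw [homComponent_mul_proj hp, mul_one, zero_mul, LinearMap.zero_apply, Module.End.mul_apply]
    exact (hLq a _).mp ((hLp a _).mpr fun b hb =>
      hp.proj_apply_of_ne (hp.apply_proj a v) (by omega)) (a + j) (by omega)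
  have hXdeg : ∀ j, T' * X j - X j * T = (j : k) • X j := fun j => homComponent_degree hp hq j 1
  have hXY : ∀ j, Y * X j = X j * Y := by
    intro j
    have h1 := homComponent_mul_left hp hq (A := Y) (d := 0) (by simp [hYT'.eq]) j 1
    have h2 := homComponent_mul_right (q := q) hp (A := Y) (d := 0) (by simp [hYT.eq]) j 1
    rw [mul_one, sub_zero] at h1
    rw [one_mul, sub_zero] at h2
    exact h1.symm.trans h2
  have hrec : ∀ j, ∑ᶠ i, M' i * X (j - i) = ∑ᶠ i, X (j - i) * M i := by
    intro j
    have h1 := homComponent_mul_eq_finsum hp hq N 1 j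
    have h2 := homComponent_mul_eq_finsum' (q := q) hp 1 N j
    rw [mul_one] at h1
    rw [one_mul] at h2
    exact h1.symm.trans h2
  have hweight : ∀ j, (Y - T') * X j - X j * (Y - T) = (-j : k) • X j := by
    intro j
    rw [neg_smul, ← hXdeg j, sub_mul, mul_sub, hXY]
    abel
  have hf : M' 0 * X 0 = X 0 * M 0 := by
    have h := hrec 0
    rw [finsum_eq_single _ 0, finsum_eq_single _ 0, sub_zero] at h
    · exact h
    · intro i hi
      rcases lt_or_gt_of_ne hi with hi | hi
      · rw [hXpos _ (by omega), zero_mul]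
      · rw [show M i = 0 from hpos i hi, mul_zero]
    · intro i hi
      rcases lt_or_gt_of_ne hi with hi | hi
      · rw [hXpos _ (by omega), mul_zero]
      · rw [show M' i = 0 from hpos' i hi, zero_mul]
  have hh : (Y - T') * X 0 = X 0 * (Y - T) := by
    simpa [sub_eq_zero] using hweight 0
  have he : e' * X 0 = X 0 * e := by
    rw [← sub_eq_zero]
    refine intertwiner_eq_zero (w := 2) hef' hhe' hef hhe (by norm_num) ?_ ?_
    · have h1 : ((2 : ℕ) : k) • (e' * X 0 - X 0 * e) =
          ((2 : k) • e') * X 0 - X 0 * ((2 : k) • e) := by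
        simp [smul_sub]
      rw [h1, ← hhe, ← hhe']
      calc _ = (Y - T') * e' * X 0 - ((Y - T') * X 0) * e - e' * (X 0 * (Y - T)) +
            X 0 * e * (Y - T) := by noncomm_ring
        _ = (Y - T') * e' * X 0 - (X 0 * (Y - T)) * e - e' * ((Y - T') * X 0) +
            X 0 * e * (Y - T) := by rw [hh]
        _ = _ := by noncomm_ring
    · have h1 : M' 0 * (e' * X 0 - X 0 * e) - (e' * X 0 - X 0 * e) * M 0 = 0 := by
        calc _ = M' 0 * e' * X 0 - (M' 0 * X 0) * e - e' * (X 0 * M 0) + X 0 * e * M 0 := by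
              noncomm_ring
          _ = M' 0 * e' * X 0 - (X 0 * M 0) * e - e' * (M' 0 * X 0) + X 0 * e * M 0 := by
              rw [hf]
          _ = X 0 * (e * M 0 - M 0 * e) - (e' * M' 0 - M' 0 * e') * X 0 := by noncomm_ring
          _ = 0 := by rw [hef, hef', hh, sub_self]
      rw [h1, mul_zero, zero_mul, sub_zero]
  have hXneg : ∀ n : ℕ, 0 < n → X (-n) = 0 := by
    intro n
    induction n using Nat.strong_induction_on with
    | _ n ih =>
      intro hn
      have hzero : ∀ i : ℤ, i < 0 → i ≠ -n → X (-n - i) = 0 := by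
        intro i hi hin
        rcases lt_or_gt_of_ne hin with h | h
        · exact hXpos _ (by omega)
        · have := ih (n + i).toNat (by omega) (by omega)
          rwa [Int.toNat_of_nonneg (by omega), neg_add, ← sub_eq_add_neg] at this
      have h := hrec (-n)
      have hne : (0 : ℤ) ≠ -n := by omega
      rw [finsum_eq_sum_of_support_subset (s := {0, -(n : ℤ)}),
        finsum_eq_sum_of_support_subset (s := {0, -(n : ℤ)}), Finset.sum_pair hne,
        Finset.sum_pair hne, sub_zero, sub_self] at h
      · have hfX : M' 0 * X (-n) - X (-n) * M 0 = X 0 * M (-n) - M' (-n) * X 0 := by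
          rw [sub_eq_sub_iff_add_eq_add, h, add_comm]
        refine intertwiner_eq_zero (w := n) hef' hhe' hef hhe hn (by simpa using hweight (-n)) ?_
        rw [hfX]
        calc _ = (e' * X 0) * M (-n) - (e' * M' (-n)) * X 0 - X 0 * (M (-n) * e) +
              M' (-n) * (X 0 * e) := by noncomm_ring
          _ = (X 0 * e) * M (-n) - (M' (-n) * e') * X 0 - X 0 * (e * M (-n)) +
              M' (-n) * (e' * X 0) := by rw [he, hcomm _ hne.symm, hcomm' _ hne.symm]
          _ = 0 := by noncomm_ring
      · intro i hi
        by_contra hmem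
        simp only [Finset.coe_insert, Finset.coe_singleton, Set.mem_insert_iff,
          Set.mem_singleton_iff, not_or] at hmem
        refine hi (?_ : X (-n - i) * M i = 0)
        rcases lt_or_gt_of_ne hmem.1 with h0 | h0
        · rw [hzero i h0 hmem.2, zero_mul]
        · rw [show M i = 0 from hpos i h0, mul_zero]
      · intro i hi
        by_contra hmem
        simp only [Finset.coe_insert, Finset.coe_singleton, Set.mem_insert_iff,
          Set.mem_singleton_iff, not_or] at hmem
        refine hi (?_ : M' i * X (-n - i) = 0)
        rcases lt_or_gt_of_ne hmem.1 with h0 | h0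
        · rw [hzero i h0 hmem.2, mul_zero]
        · rw [show M' i = 0 from hpos' i h0, zero_mul]
  have hX0 : X 0 = 1 := by
    have h := finsum_homComponent hp hq (1 : Module.End k V)
    rwa [finsum_eq_single _ 0] at h
    intro j hj
    rcases lt_or_gt_of_ne hj with hj | hj
    · have := hXneg (-j).toNat (by omega)
      rwa [Int.toNat_of_nonneg (by omega), neg_neg] at this
    · exact hXpos j hj
  have := hXdeg 0
  rwa [hX0, mul_one, one_mul, Int.cast_zero, zero_smul, sub_eq_zero] at this

end Uniqueness

section Conj

variable {Y₀ : Module.End k V} {S : Finset ℤ} {p : ℤ → Module.End k V}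

theorem commutator_degree {T A B : Module.End k V} {c d : k} (hA : T * A - A * T = c • A)
    (hB : T * B - B * T = d • B) :
    T * (A * B - B * A) - (A * B - B * A) * T = (c + d) • (A * B - B * A) := by
  have h : T * (A * B - B * A) - (A * B - B * A) * T =
      (T * A - A * T) * B - B * (T * A - A * T) + (A * (T * B - B * T) - (T * B - B * T) * A) := by
    noncomm_ring
  rw [h, hA, hB]
  simp only [smul_mul_assoc, mul_smul_comm]
  module

theorem IsSpectralFamily.conj (hp : IsSpectralFamily Y₀ S p) {g g' : Module.End k V}
    (hg : g * g' = 1) (hg' : g' * g = 1) :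
    IsSpectralFamily (g * Y₀ * g') S fun a => g * p a * g' where
  mul_proj i := by
    calc _ = g * Y₀ * (g' * g) * p i * g' := by noncomm_ring
      _ = g * (Y₀ * p i) * g' := by rw [hg']; noncomm_ring
      _ = _ := by rw [hp.mul_proj, mul_smul_comm, smul_mul_assoc]
  proj_mul i := by
    calc _ = g * p i * (g' * g) * Y₀ * g' := by noncomm_ring
      _ = g * (p i * Y₀) * g' := by rw [hg']; noncomm_ring
      _ = _ := by rw [hp.proj_mul, mul_smul_comm, smul_mul_assoc]
  eq_zero i hi := by rw [hp.eq_zero i hi, mul_zero, zero_mul]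
  sum_eq_one := by rw [← Finset.sum_mul, ← Finset.mul_sum, hp.sum_eq_one, mul_one, hg]

theorem homComponent_conj (g g' X : Module.End k V) (j : ℤ) :
    homComponent (fun a => g * p a * g') (fun a => g * p a * g') S j X =
      g * homComponent p p S j (g' * X * g) * g' := by
  rw [homComponent_apply, homComponent_apply, Finset.mul_sum, Finset.sum_mul]
  exact Finset.sum_congr rfl fun a _ => by noncomm_ring

end Conj

section Existence

variable [CharZero k] {Y Y₀ N : Module.End k V} {S Sy : Finset ℤ} {p y : ℤ → Module.End k V}
  {L : ℤ → Submodule k V}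

theorem homComponent_eq_zero_of_mapsTo (hp : IsSpectralFamily Y₀ S p)
    (hL : ∀ i v, v ∈ L i ↔ ∀ b, i < b → p b v = 0) (hNL : ∀ i, ∀ x ∈ L i, N x ∈ L i) {j : ℤ}
    (hj : 0 < j) : homComponent p p S j N = 0 := by
  refine hp.ext_right fun a => LinearMap.ext fun v => ?_
  rw [homComponent_mul_proj hp, zero_mul, LinearMap.zero_apply, Module.End.mul_apply,
    Module.End.mul_apply]
  exact (hL a _).mp (hNL a _ ((hL a _).mpr fun b hb =>
    hp.proj_apply_of_ne (hp.apply_proj a v) (by omega))) (a + j) (by omega)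

theorem iSup_ker_sub_eq_top (hy : IsSpectralFamily Y Sy y) (hp : IsSpectralFamily Y₀ S p)
    (hYY₀ : Commute Y Y₀) : (⨆ j : ℤ, LinearMap.ker (Y - Y₀ - (j : k) • 1)) = ⊤ := by
  refine eq_top_iff.mpr fun v _ => ?_
  rw [← hp.sum_apply v]
  refine Submodule.sum_mem _ fun m _ => ?_
  rw [← hy.sum_apply (p m v)]
  refine Submodule.sum_mem _ fun a _ => Submodule.mem_iSup_of_mem (a - m) ?_
  have h : Y₀ * (y a * p m) = (m : k) • (y a * p m) := by
    rw [← mul_assoc, ← hy.proj_commute hYY₀, mul_assoc, hp.mul_proj, mul_smul_comm]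
  have h' : Y₀ (y a (p m v)) = (m : k) • y a (p m v) := LinearMap.congr_fun h v
  simp [hy.apply_proj, h', sub_smul]

theorem isNilpotent_of_degree_neg (hp : IsSpectralFamily Y₀ S p) {γ : Module.End k V} {d : ℤ}
    (hd : d < 0) (hγ : Y₀ * γ - γ * Y₀ = (d : k) • γ) : IsNilpotent γ := by
  have hpow : ∀ i : ℕ, Y₀ * γ ^ i - γ ^ i * Y₀ = ((i * d : ℤ) : k) • γ ^ i := by
    intro i
    induction i with
    | zero => simp
    | succ i ih =>
      have h : Y₀ * γ ^ (i + 1) - γ ^ (i + 1) * Y₀ =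
          (Y₀ * γ ^ i - γ ^ i * Y₀) * γ + γ ^ i * (Y₀ * γ - γ * Y₀) := by
        rw [pow_succ]
        noncomm_ring
      rw [h, ih, hγ, smul_mul_assoc, mul_smul_comm, ← pow_succ, ← add_smul]
      congr 1
      push_cast
      ring
  obtain ⟨B, hB⟩ := exists_homComponent_eq_zero hp hp
  refine ⟨B + 1, ?_⟩
  have h := hB (((B + 1 : ℕ) : ℤ) * d) ?_ (γ ^ (B + 1))
  · simpa [homComponent_of_degree hp hp (hpow (B + 1))] using h
  · rw [abs_mul, Nat.abs_cast]
    have : 1 ≤ |d| := Int.one_le_abs hd.ne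
    push_cast
    nlinarith

theorem exists_commute_add_commutator [FiniteDimensional k V] {e f A : Module.End k V}
    (hef : e * f - f * e = Y - Y₀)
    (hYe : Y * e - e * Y = (2 : k) • e) (hYf : Y * f - f * Y = (-2 : k) • f)
    (hY₀e : Commute Y₀ e) (hY₀f : Commute Y₀ f) {n : ℕ} (hn : 0 < n)
    (hYA : Y * A - A * Y = (-2 : k) • A) (hY₀A : Y₀ * A - A * Y₀ = (-n : k) • A) :
    ∃ γ, Commute Y γ ∧ Y₀ * γ - γ * Y₀ = (-n : k) • γ ∧
      Commute e (A + (f * γ - γ * f)) := by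
  let ad : Module.End k V → Module.End k (Module.End k V) := fun X =>
    LinearMap.mulLeft k X - LinearMap.mulRight k X
  have had : ∀ X Z, ad X Z = X * Z - Z * X := fun X Z => rfl
  let U : Submodule k (Module.End k V) :=
    LinearMap.ker (ad Y) ⊓ LinearMap.ker (ad Y₀ - (-n : k) • 1)
  have hU : ∀ Z, Z ∈ U ↔ Y * Z - Z * Y = (0 : k) • Z ∧ Y₀ * Z - Z * Y₀ = (-n : k) • Z := by
    intro Z
    rw [Submodule.mem_inf, LinearMap.mem_ker, LinearMap.mem_ker, zero_smul]
    change Y * Z - Z * Y = 0 ∧ Y₀ * Z - Z * Y₀ - (-n : k) • Z = 0 ↔ _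
    rw [sub_eq_zero (b := (-n : k) • Z)]
  have hY₀e' : Y₀ * e - e * Y₀ = (0 : k) • e := by simp [hY₀e.eq]
  have hY₀f' : Y₀ * f - f * Y₀ = (0 : k) • f := by simp [hY₀f.eq]
  have hmaps : ∀ Z ∈ U, (ad e ∘ₗ ad f) Z ∈ U := by
    intro Z hZ
    obtain ⟨h1, h2⟩ := (hU Z).mp hZ
    refine (hU _).mpr ⟨?_, ?_⟩
    · exact (commutator_degree hYe (commutator_degree hYf h1)).trans (congrArg (· • _) (by ring))
    · exact (commutator_degree hY₀e' (commutator_degree hY₀f' h2)).trans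
        (congrArg (· • _) (by ring))
  have hinj : Function.Injective ((ad e ∘ₗ ad f).restrict hmaps) := by
    rw [injective_iff_map_eq_zero]
    rintro ⟨Z, hZ⟩ h
    obtain ⟨h1, h2⟩ := (hU Z).mp hZ
    have h3 : e * (f * Z - Z * f) - (f * Z - Z * f) * e = 0 := congrArg Subtype.val h
    have hhe : (Y - Y₀) * e - e * (Y - Y₀) = (2 : k) • e := by
      rw [← hYe, sub_mul, mul_sub, hY₀e.eq]
      abel
    refine Subtype.ext (intertwiner_eq_zero hef hhe hef hhe hn ?_ h3)
    have h4 : (Y - Y₀) * Z - Z * (Y - Y₀) = (Y * Z - Z * Y) - (Y₀ * Z - Z * Y₀) := by noncomm_ring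
    rw [h4, h1, h2]
    module
  have hmem : A * e - e * A ∈ U := by
    refine (hU _).mpr ⟨?_, ?_⟩
    · convert commutator_degree hYA hYe using 2
      ring
    · convert commutator_degree hY₀A hY₀e' using 2
      ring
  obtain ⟨⟨γ, hγ⟩, h⟩ := LinearMap.injective_iff_surjective.mp hinj ⟨_, hmem⟩
  obtain ⟨h1, h2⟩ := (hU γ).mp hγ
  refine ⟨γ, sub_eq_zero.mp (by simpa using h1), h2, ?_⟩
  have h3 : e * (f * γ - γ * f) - (f * γ - γ * f) * e = A * e - e * A := congrArg Subtype.val h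
  change e * (A + (f * γ - γ * f)) = (A + (f * γ - γ * f)) * e
  rw [mul_add, add_mul, ← sub_eq_zero, add_sub_add_comm, h3]
  abel

/-- Conjugation by `1 + γ`, with `γ` of degree `-n`, changes the components of `M` only in degrees
at most `-n`. -/
theorem homComponent_conj_one_add (hp : IsSpectralFamily Y₀ S p) {M M' γ : Module.End k V} {n : ℕ}
    (hn : 0 < n) (hγ : Y₀ * γ - γ * Y₀ = (-n : k) • γ)
    (hM : ∀ j, 0 < j → homComponent p p S j M = 0) (hMM' : (1 + γ) * M' = M * (1 + γ)) :
    (∀ j, -(n : ℤ) < j → homComponent p p S j M' = homComponent p p S j M) ∧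
      homComponent p p S (-n) M' = homComponent p p S (-n) M +
        (homComponent p p S 0 M * γ - γ * homComponent p p S 0 M) := by
  have hγ' : Y₀ * γ - γ * Y₀ = ((-n : ℤ) : k) • γ := by simpa using hγ
  have hrec : ∀ j, homComponent p p S j M' = homComponent p p S j M +
      (homComponent p p S (j + n) M * γ - γ * homComponent p p S (j + n) M') := by
    intro j
    have h : M' = M + (M * γ - γ * M') := by
      rw [mul_add, add_mul, mul_one, one_mul] at hMM'
      rw [← add_sub_assoc, ← hMM', add_sub_cancel_right]
    conv_lhs => rw [h]
    rw [map_add, map_sub, homComponent_mul_left hp hp hγ', homComponent_mul_right hp hγ',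
      sub_neg_eq_add]
  obtain ⟨B, hB⟩ := exists_homComponent_eq_zero hp hp
  have hpos' : ∀ t : ℕ, ∀ j, 0 < j → (B : ℤ) - t < j → homComponent p p S j M' = 0 := by
    intro t
    induction t with
    | zero =>
      intro j hj hjB
      exact hB j (by rw [abs_of_pos hj]; simpa using hjB) M'
    | succ t ih =>
      intro j hj hjB
      rw [hrec, hM j hj, hM (j + n) (by omega), ih (j + n) (by omega) (by push_cast at hjB; omega)]
      simp
  have hpos : ∀ j, 0 < j → homComponent p p S j M' = 0 := fun j hj => hpos' B j hj (by omega)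
  have hlt : ∀ j, -(n : ℤ) < j → homComponent p p S j M' = homComponent p p S j M := by
    intro j hj
    rw [hrec, hM (j + n) (by omega), hpos (j + n) (by omega)]
    simp
  refine ⟨hlt, ?_⟩
  rw [hrec, neg_add_cancel, hlt 0 (by omega)]

theorem exists_conj_commute [FiniteDimensional k V] (hp : IsSpectralFamily Y₀ S p)
    (hL : ∀ i v, v ∈ L i ↔ ∀ b, i < b → p b v = 0) (hYY₀ : Commute Y Y₀)
    (hYN : Y * N - N * Y = (-2 : k) • N) (hN : ∀ j, 0 < j → homComponent p p S j N = 0)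
    {e : Module.End k V}
    (hef : e * homComponent p p S 0 N - homComponent p p S 0 N * e = Y - Y₀)
    (hYe : Y * e - e * Y = (2 : k) • e) (hY₀e : Commute Y₀ e) (n : ℕ) :
    ∃ g g' : Module.End k V, g * g' = 1 ∧ g' * g = 1 ∧ Commute Y g ∧
      (∀ i, ∀ x ∈ L i, g x ∈ L i) ∧
      (∀ j, 0 < j → homComponent p p S j (g' * N * g) = 0) ∧
      homComponent p p S 0 (g' * N * g) = homComponent p p S 0 N ∧
      ∀ j, -(n : ℤ) ≤ j → j ≠ 0 → Commute e (homComponent p p S j (g' * N * g)) := by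
  induction n with
  | zero =>
    refine ⟨1, 1, mul_one 1, mul_one 1, Commute.one_right Y, fun i x hx => hx, ?_⟩
    rw [one_mul, mul_one]
    refine ⟨hN, rfl, fun j hj hj0 => ?_⟩
    rw [hN j (by omega)]
    exact Commute.zero_right e
  | succ n ih =>
    obtain ⟨g, g', hgg', hg'g, hYg, hgL, hpos, hzero, hcomm⟩ := ih
    set M := g' * N * g with hM
    have hYg' : Y * g' = g' * Y := by
      calc Y * g' = g' * g * (Y * g') := by rw [hg'g, one_mul]
        _ = g' * (g * Y) * g' := by noncomm_ring
        _ = g' * Y * (g * g') := by rw [← hYg.eq]; noncomm_ring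
        _ = g' * Y := by rw [hgg', mul_one]
    have hYM : Y * M - M * Y = (-2 : k) • M := by
      have h : Y * M - M * Y = g' * (Y * N - N * Y) * g := by
        rw [hM, mul_assoc _ g Y, ← hYg.eq, mul_assoc g' N g, ← mul_assoc Y g', hYg']
        noncomm_ring
      rw [h, hYN, mul_smul_comm, smul_mul_assoc]
    have hY₀f : Commute Y₀ (homComponent p p S 0 N) := by
      have := homComponent_degree hp hp 0 N
      rwa [Int.cast_zero, zero_smul, sub_eq_zero] at this
    obtain ⟨γ, hYγ, hY₀γ, hγ⟩ := exists_commute_add_commutator (n := n + 1)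
      (A := homComponent p p S (-((n + 1 : ℕ) : ℤ)) M) hef hYe
      (homComponent_lower hp hYY₀ hYN 0) hY₀e hY₀f n.succ_pos (homComponent_lower hp hYY₀ hYM _)
      (by simpa using homComponent_degree hp hp (-((n + 1 : ℕ) : ℤ)) M)
    have hγ' : Y₀ * γ - γ * Y₀ = ((-((n + 1 : ℕ) : ℤ) : ℤ) : k) • γ := by simpa using hY₀γ
    obtain ⟨u, hu⟩ := (isNilpotent_of_degree_neg hp (by omega) hγ').isUnit_one_add
    have hM' : (↑u⁻¹ * g') * N * (g * (u : Module.End k V)) = ↑u⁻¹ * M * u := by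
      rw [hM]
      noncomm_ring
    have hMM' : (1 + γ) * (↑u⁻¹ * M * u) = M * (1 + γ) := by
      rw [← hu, mul_assoc, Units.mul_inv_cancel_left]
    obtain ⟨hlt, heq⟩ := homComponent_conj_one_add hp n.succ_pos hY₀γ hpos hMM'
    refine ⟨g * u, ↑u⁻¹ * g', ?_, ?_, ?_, ?_, ?_⟩
    · rw [mul_assoc, Units.mul_inv_cancel_left, hgg']
    · rw [mul_assoc, ← mul_assoc g', hg'g, one_mul, Units.inv_mul]
    · rw [hu]
      exact hYg.mul_right ((Commute.one_right Y).add_right hYγ)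
    · intro i x hx
      refine hgL i _ ?_
      rw [hu, LinearMap.add_apply, Module.End.one_apply]
      refine Submodule.add_mem _ hx ((hL i _).mpr fun b hb => ?_)
      have h := LinearMap.congr_fun (hp.proj_mul_eq hp hγ' (b + (n + 1 : ℕ))) x
      rw [add_neg_cancel_right] at h
      refine h.trans ?_
      rw [Module.End.mul_apply, (hL i x).mp hx _ (by omega), map_zero]
    · rw [hM']
      refine ⟨fun j hj => (hlt j (by omega)).trans (hpos j hj), (hlt 0 (by omega)).trans hzero,
        fun j hj hj0 => ?_⟩
      rcases hj.eq_or_lt with rfl | hj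
      · rw [heq, hzero]
        exact hγ
      · rw [hlt j hj]
        exact hcomm j (by push_cast at hj; omega) hj0

theorem exists_deligne_splitting [FiniteDimensional k V] (hp : IsSpectralFamily Y₀ S p)
    (hL : ∀ i v, v ∈ L i ↔ ∀ b, i < b → p b v = 0) (hYY₀ : Commute Y Y₀)
    (hYN : Y * N - N * Y = (-2 : k) • N) (hN : ∀ j, 0 < j → homComponent p p S j N = 0)
    {e : Module.End k V}
    (hef : e * homComponent p p S 0 N - homComponent p p S 0 N * e = Y - Y₀)
    (hYe : Y * e - e * Y = (2 : k) • e) (hY₀e : Commute Y₀ e) :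
    ∃ Y' : Module.End k V, IsSplittingOp Y' L ∧ Commute Y Y' ∧ DeligneCompat Y Y' N := by
  obtain ⟨B, hB⟩ := exists_homComponent_eq_zero hp hp
  obtain ⟨g, g', hgg', hg'g, hYg, hgL, hpos, hzero, hcomm⟩ :=
    exists_conj_commute hp hL hYY₀ hYN hN hef hYe hY₀e B
  have hcomm' : ∀ j, j ≠ 0 → Commute e (homComponent p p S j (g' * N * g)) := by
    intro j hj0
    by_cases hj : -(B : ℤ) ≤ j
    · exact hcomm j hj hj0
    · rw [hB j (by rw [abs_of_neg] <;> omega)]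
      exact Commute.zero_right e
  have hY : g * Y * g' = Y := by rw [← hYg.eq, mul_assoc, hgg', mul_one]
  have hmul : ∀ A C : Module.End k V, (g * A * g') * (g * C * g') = g * (A * C) * g' := by
    intro A C
    calc _ = g * A * (g' * g) * C * g' := by noncomm_ring
      _ = _ := by rw [hg'g]; noncomm_ring
  have hsub : ∀ A C : Module.End k V, g * A * g' - g * C * g' = g * (A - C) * g' := by
    intro A C
    noncomm_ring
  have hp' := hp.conj hgg' hg'g
  have hg'L : ∀ i x, x ∈ L i ↔ g' x ∈ L i := by
    have hgg'x : ∀ x, g (g' x) = x := LinearMap.congr_fun hgg'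
    have hg'gx : ∀ x, g' (g x) = x := LinearMap.congr_fun hg'g
    refine fun i x => ⟨fun hx => ?_, fun hx => hgg'x x ▸ hgL i _ hx⟩
    have hinj : Function.Injective (g.restrict (hgL i)) := fun a b hab =>
      Subtype.ext (Function.LeftInverse.injective hg'gx (congrArg Subtype.val hab))
    obtain ⟨⟨z, hz⟩, h⟩ := LinearMap.injective_iff_surjective.mp hinj ⟨x, hx⟩
    have h' : g z = x := congrArg Subtype.val h
    rwa [← h', hg'gx]
  refine ⟨g * Y₀ * g', ⟨hp'.iSup_ker_eq_top, fun i => ?_⟩, ?_, ?_⟩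
  · ext x
    rw [hp'.mem_iSup_le_iff, hg'L, hL]
    refine forall₂_congr fun b _ => ⟨fun h => ?_, fun h => ?_⟩
    · simp [h]
    · have h' := congrArg g' h
      rw [map_zero] at h'
      exact (LinearMap.congr_fun hg'g _).symm.trans h'
  · change Y * (g * Y₀ * g') = g * Y₀ * g' * Y
    rw [← hY, hmul, hmul, hYY₀.eq]
  · rw [deligneCompat_iff hp']
    simp_rw [homComponent_conj]
    refine ⟨fun j hj => by simp [hpos j hj], g * e * g', ?_, ?_, fun j hj => ?_⟩
    · rw [hzero, hmul, hmul, hsub, hef, ← hsub, hY]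
    · conv_lhs => rw [← hY]
      rw [hsub, hmul, hmul, hsub, ← smul_mul_assoc, ← mul_smul_comm, ← hYe, sub_mul, mul_sub,
        hY₀e.eq]
      noncomm_ring
    · rw [hmul, hmul, (hcomm' j hj).eq]

end Existence

/-- **Deligne.**  Let `k` be a field of characteristic zero, `V` a
finite-dimensional `k`-vector space, `L` a finite increasing filtration of `V`, `N` a
nilpotent endomorphism preserving `L`, and `Y` a semisimple endomorphism with integer
eigenvalues satisfying the admissibility conditions `[Y, N] = -2N` and `Y(L_i) ⊆ L_i`.
Let `W_m := ⊕_{a ≤ m} ker(Y - a·id)`.  Assume (1) `W` is the relative monodromy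
filtration of `N` along `L` (for every `m` and `i > 0`, `N^i` induces an isomorphism
between the indicated subquotients) and (2) there exists a splitting operator for `L`
commuting with `Y`.  Then there is a *unique* splitting operator `Y'` for `L` commuting
with `Y` such that `(V, L, N, Y, Y')` is a Deligne system. -/
theorem statement7 [CharZero k] [FiniteDimensional k V]
    (L : ℤ → Submodule k V) (hLmono : Monotone L)
    (hLbot : ∃ a : ℤ, L a = ⊥) (hLtop : ∃ b : ℤ, L b = ⊤)
    (N : Module.End k V) (hNnil : IsNilpotent N)
    (hNL : ∀ i : ℤ, ∀ x ∈ L i, N x ∈ L i)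
    (Y : Module.End k V)
    (hYss : (⨆ a : ℤ, LinearMap.ker (Y - (a : k) • 1)) = ⊤)
    (hYN : Y * N - N * Y = (-2 : k) • N)
    (hYL : ∀ i : ℤ, ∀ x ∈ L i, Y x ∈ L i)
    (W : ℤ → Submodule k V)
    (hW : ∀ m : ℤ, W m = ⨆ a : ℤ, ⨆ _ : a ≤ m, LinearMap.ker (Y - (a : k) • 1))
    (hrel : ∀ (m : ℤ) (i : ℕ), 0 < i →
      (∀ x ∈ (W (m + i) ⊓ L m) ⊔ L (m - 1),
        (N ^ i) x ∈ (W (m - i) ⊓ L m) ⊔ L (m - 1)) ∧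
      (∀ x ∈ (W (m + i - 1) ⊓ L m) ⊔ L (m - 1),
        (N ^ i) x ∈ (W (m - i - 1) ⊓ L m) ⊔ L (m - 1)) ∧
      (∀ y ∈ (W (m - i) ⊓ L m) ⊔ L (m - 1),
        ∃ x ∈ (W (m + i) ⊓ L m) ⊔ L (m - 1),
          (N ^ i) x - y ∈ (W (m - i - 1) ⊓ L m) ⊔ L (m - 1)) ∧
      (∀ x ∈ (W (m + i) ⊓ L m) ⊔ L (m - 1),
        (N ^ i) x ∈ (W (m - i - 1) ⊓ L m) ⊔ L (m - 1) →
          x ∈ (W (m + i - 1) ⊓ L m) ⊔ L (m - 1)))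
    (hexists : ∃ Y₀ : Module.End k V, IsSplittingOp Y₀ L ∧ Commute Y Y₀) :
    ∃! Y' : Module.End k V,
      IsSplittingOp Y' L ∧ Commute Y Y' ∧ DeligneCompat Y Y' N := by
  obtain ⟨Y₀, ⟨hY₀, hLY₀⟩, hYY₀⟩ := hexists
  obtain ⟨Sy, y, hy⟩ := IsSpectralFamily.exists_of_iSup_ker_eq_top Y hYss
  obtain ⟨S, p, hp⟩ := IsSpectralFamily.exists_of_iSup_ker_eq_top Y₀ hY₀
  obtain ⟨R, r, hr⟩ :=
    IsSpectralFamily.exists_of_iSup_ker_eq_top (Y - Y₀) (iSup_ker_sub_eq_top hy hp hYY₀)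
  have hW' : ∀ i v, v ∈ W i ↔ ∀ b, i < b → y b v = 0 := fun i v => by
    rw [hW, hy.mem_iSup_le_iff]
  have hL : ∀ i v, v ∈ L i ↔ ∀ b, i < b → p b v = 0 := fun i v => by
    rw [hLY₀, hp.mem_iSup_le_iff]
  have hN : ∀ j, 0 < j → homComponent p p S j N = 0 := fun j hj =>
    homComponent_eq_zero_of_mapsTo hp hL hNL hj
  have hYf := homComponent_lower hp hYY₀ hYN 0
  have hY₀f : Commute Y₀ (homComponent p p S 0 N) := by
    have := homComponent_degree hp hp 0 N
    rwa [Int.cast_zero, zero_smul, sub_eq_zero] at this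
  have hHf : (Y - Y₀) * homComponent p p S 0 N - homComponent p p S 0 N * (Y - Y₀) =
      (-2 : k) • homComponent p p S 0 N := by
    rw [← hYf, sub_mul, mul_sub, hY₀f.eq]
    abel
  obtain ⟨e, hef, hhe, hY₀e⟩ := exists_raising_operator hr hp
    (hYY₀.symm.sub_right (Commute.refl Y₀)) hHf hY₀f
    (fun i hi x hx hfx => eq_zero_of_pow_homComponent_eq_zero hy hYY₀ hp hL hW' hN
      (fun m => (hrel m i hi).2.2.2) hx hfx)
    (fun i hi z hz => exists_pow_homComponent_eq hy hYY₀ hp hL hW' hYN hN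
      (fun m => (hrel m i hi).2.2.1) hz)
  have hYe : Y * e - e * Y = (2 : k) • e := by
    rw [← hhe, sub_mul, mul_sub, hY₀e.eq]
    abel
  obtain ⟨T, hTL, hYT, hT⟩ := exists_deligne_splitting hp hL hYY₀ hYN hN hef hYe hY₀e
  refine ⟨T, ⟨hTL, hYT, hT⟩, fun T' ⟨hTL', hYT', hT'⟩ => ?_⟩
  obtain ⟨_, q, hq⟩ := IsSpectralFamily.exists_of_iSup_ker_eq_top T hTL.1
  obtain ⟨_, q', hq'⟩ := IsSpectralFamily.exists_of_iSup_ker_eq_top T' hTL'.1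
  exact deligne_splitting_unique (L := L) hq hq' (fun i v => by rw [hTL.2, hq.mem_iSup_le_iff])
    (fun i v => by rw [hTL'.2, hq'.mem_iSup_le_iff]) hYT hYT' hT hT'
end
end
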